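/- arXiv:2411.16069 — 3 statements merged into one kernel-verified Lean document; each statement's English description precedes it below -/
import Mathlib

section
/- Let 0 < η ≤ 1, 0 < β ≤ 1, 0 < δ < 1/2, let ε > 0 be sufficiently small with η + β ≥ 4(1+δ)/3 + ε, set Δ = N^{−δ}, X = 2Δ|𝔄||𝔅| and α = ((η+β)/2 − 2/3 − 2δ/3)/(η+β−δ) − ε. Then for any constants c₂ ≥ c₁ > 0 there exist a constant C > 0 and N₀ such that for all N ≥ N₀ and all 𝔄, 𝔅 ⊆ {N+1, …, 2N} with c₁N^η ≤ |𝔄| ≤ c₂N^η and c₁N^β ≤ |𝔅| ≤ c₂N^β, one has Σ_{1 ≤ d < X^α} μ²(d) · 3^{ν(d)} · |r(𝒜,d)| ≤ C · X · N^{−ε/2}, where ν(d) is the number of distinct prime factors of d and μ is the Möbius function. -/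
open scoped Classical

/-- `ψ(t) = t − ⌊t⌋ − 1/2`. -/
noncomputable def psiSaw (t : ℝ) : ℝ := t - ⌊t⌋ - 1 / 2

/-- The remainder term `r(𝒜,d)` from (3.15):
`r(𝒜,d) = Σ_{a∈𝔄} Σ_{b∈𝔅} (ψ((√(ab) − Δ)/d) − ψ((√(ab) + Δ)/d))`. -/
noncomputable def remTerm (A B : Finset ℕ) (Δ : ℝ) (d : ℕ) : ℝ :=
  ∑ a ∈ A, ∑ b ∈ B,
    (psiSaw ((Real.sqrt (a * b) - Δ) / d) - psiSaw ((Real.sqrt (a * b) + Δ) / d))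

/-- The periodic primitive `({x}² − {x}) / 2` of the sawtooth function. -/
noncomputable def sawPrimitive (x : ℝ) : ℝ := (Int.fract x ^ 2 - Int.fract x) / 2

lemma psiSaw_le_add_sub {x y : ℝ} (h : y ≤ x) : psiSaw x ≤ psiSaw y + (x - y) := by
  have : (⌊y⌋ : ℝ) ≤ ⌊x⌋ := by exact_mod_cast Int.floor_mono h
  unfold psiSaw
  linarith

/-- `sawPrimitive x - x ^ 2 / 2` is concave, with supergradient `psiSaw x - x`. -/
lemma sawPrimitive_sub_sq_le (x y : ℝ) :
    sawPrimitive y - y ^ 2 / 2 ≤ sawPrimitive x - x ^ 2 / 2 + (psiSaw x - x) * (y - x) := by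
  unfold sawPrimitive psiSaw Int.fract
  set n := ⌊x⌋
  set m := ⌊y⌋ with hm
  have h1 : (m : ℝ) ≤ y := Int.floor_le y
  have h2 : y < m + 1 := Int.lt_floor_add_one y
  have key : 0 ≤ ((n : ℝ) - m) * ((n + m + 1) / 2 - y) := by
    rcases lt_trichotomy n m with h | h | h
    · have : (n : ℝ) + 1 ≤ m := by exact_mod_cast h
      apply mul_nonneg_of_nonpos_of_nonpos <;> linarith
    · simp [h]
    · have : (m : ℝ) + 1 ≤ n := by exact_mod_cast h
      apply mul_nonneg <;> linarith
  nlinarith [key]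

/-- The sawtooth function averaged over short intervals, used as a majorant of
`x ↦ psiSaw (x - D) - psiSaw (x + D)`. -/
noncomputable def smoothedSaw (κ D x : ℝ) : ℝ :=
  (sawPrimitive (x - D - κ) - sawPrimitive (x - D - 2 * κ)
    - (sawPrimitive (x + D + 2 * κ) - sawPrimitive (x + D + κ))) / κ

lemma psiSaw_sub_le_smoothedSaw {κ : ℝ} (hκ : 0 < κ) (D x u : ℝ) (hu : 0 ≤ u) (huκ : u ≤ κ) :
    psiSaw (x - D) - psiSaw (x + D) ≤ smoothedSaw κ D (x + u) + 4 * κ := by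
  have h1 := psiSaw_le_add_sub (x := x - D) (y := x + u - D - κ) (by linarith)
  have h2 := sawPrimitive_sub_sq_le (x + u - D - κ) (x + u - D - 2 * κ)
  have h3 := psiSaw_le_add_sub (x := x + u + D + κ) (y := x + D) (by linarith)
  have h4 := sawPrimitive_sub_sq_le (x + u + D + κ) (x + u + D + 2 * κ)
  have : (psiSaw (x - D) - psiSaw (x + D) - 4 * κ) * κ ≤ smoothedSaw κ D (x + u) * κ := by
    rw [smoothedSaw, div_mul_cancel₀ _ hκ.ne']
    nlinarith [mul_le_mul_of_nonneg_right h1 hκ.le, mul_le_mul_of_nonneg_right h3 hκ.le]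
  linarith [le_of_mul_le_mul_right this hκ]

lemma hasSum_sawPrimitive (x : ℝ) :
    HasSum (fun n : ℕ => Real.cos (2 * Real.pi * n * x) / (2 * Real.pi ^ 2 * n ^ 2))
      (sawPrimitive x + 1 / 12) := by
  have h := hasSum_one_div_nat_pow_mul_cos (k := 1) one_ne_zero (x := Int.fract x)
    ⟨Int.fract_nonneg x, (Int.fract_lt_one x).le⟩
  have hB := bernoulliFun_two (Int.fract x)
  unfold bernoulliFun at hB
  rw [show 2 * 1 = 2 by norm_num, hB] at h
  have h' := h.div_const (2 * Real.pi ^ 2)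
  have hpi := Real.pi_ne_zero
  convert! h' using 1
  · ext n
    have : Real.cos (2 * Real.pi * n * Int.fract x) = Real.cos (2 * Real.pi * n * x) := by
      rw [← Real.cos_sub_int_mul_two_pi (2 * Real.pi * n * x) (n * ⌊x⌋)]
      congr 1
      unfold Int.fract
      push_cast
      ring
    rw [this]
    rcases eq_or_ne n 0 with rfl | hn
    · simp
    · have : (n : ℝ) ≠ 0 := by exact_mod_cast hn
      field_simp
  · unfold sawPrimitive
    norm_num [Nat.factorial]
    field_simp
    ring

/-- The Fourier coefficients of `smoothedSaw κ D`. -/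
noncomputable def smoothedSawCoeff (κ D : ℝ) (n : ℕ) : ℝ :=
  (Real.cos (2 * Real.pi * n * (D + κ)) - Real.cos (2 * Real.pi * n * (D + 2 * κ))) /
    (Real.pi ^ 2 * n ^ 2 * κ)

lemma hasSum_smoothedSaw {κ : ℝ} (hκ : 0 < κ) (D x : ℝ) :
    HasSum (fun n : ℕ => smoothedSawCoeff κ D n * Real.cos (2 * Real.pi * n * x))
      (smoothedSaw κ D x) := by
  have h := (((hasSum_sawPrimitive (x - D - κ)).sub (hasSum_sawPrimitive (x - D - 2 * κ))).sub
    ((hasSum_sawPrimitive (x + D + 2 * κ)).sub (hasSum_sawPrimitive (x + D + κ)))).div_const κ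
  convert! h using 1
  · ext n
    have e1 := Real.cos_add (2 * Real.pi * n * x) (2 * Real.pi * n * (D + κ))
    have e2 := Real.cos_sub (2 * Real.pi * n * x) (2 * Real.pi * n * (D + κ))
    have e3 := Real.cos_add (2 * Real.pi * n * x) (2 * Real.pi * n * (D + 2 * κ))
    have e4 := Real.cos_sub (2 * Real.pi * n * x) (2 * Real.pi * n * (D + 2 * κ))
    rw [show 2 * Real.pi * n * (x - D - κ)
        = 2 * Real.pi * n * x - 2 * Real.pi * n * (D + κ) by ring,
      show 2 * Real.pi * n * (x - D - 2 * κ)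
        = 2 * Real.pi * n * x - 2 * Real.pi * n * (D + 2 * κ) by ring,
      show 2 * Real.pi * n * (x + D + κ)
        = 2 * Real.pi * n * x + 2 * Real.pi * n * (D + κ) by ring,
      show 2 * Real.pi * n * (x + D + 2 * κ)
        = 2 * Real.pi * n * x + 2 * Real.pi * n * (D + 2 * κ) by ring, e1, e2, e3, e4]
    unfold smoothedSawCoeff
    rcases eq_or_ne n 0 with rfl | hn
    · simp
    · have : (n : ℝ) ≠ 0 := by exact_mod_cast hn
      have hpi := Real.pi_ne_zero
      field_simp
      ring
  · unfold smoothedSaw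
    ring

lemma abs_smoothedSawCoeff_le {κ : ℝ} (hκ : 0 < κ) (D : ℝ) (n : ℕ) :
    |smoothedSawCoeff κ D n| ≤ 4 * |D| + 6 * κ ∧ |smoothedSawCoeff κ D n| ≤ 1 / n ∧
      |smoothedSawCoeff κ D n| ≤ 1 / (κ * n ^ 2) := by
  rcases Nat.eq_zero_or_pos n with rfl | hn
  · simp only [smoothedSawCoeff]
    simp
    positivity
  have hn' : (0 : ℝ) < n := by exact_mod_cast hn
  have hpi := Real.pi_pos
  have hpi3 := Real.pi_gt_three
  have hq : 0 < Real.pi ^ 2 * n ^ 2 * κ := by positivity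
  have hs : |Real.sin (Real.pi * n * κ)| ≤ Real.pi * n * κ := by
    have := Real.abs_sin_le_abs (x := Real.pi * n * κ)
    rwa [abs_of_pos (a := Real.pi * n * κ) (by positivity)] at this
  have hs1 := Real.abs_sin_le_one (Real.pi * n * κ)
  have ht1 := Real.abs_sin_le_one (Real.pi * n * (2 * D + 3 * κ))
  have ht : |Real.sin (Real.pi * n * (2 * D + 3 * κ))| ≤ Real.pi * n * (2 * |D| + 3 * κ) := by
    refine Real.abs_sin_le_abs.trans ?_
    rw [abs_mul, abs_of_pos (a := Real.pi * n) (by positivity)]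
    gcongr
    refine (abs_add_le _ _).trans ?_
    rw [abs_mul, abs_mul, abs_of_pos hκ]
    norm_num
  have e : |smoothedSawCoeff κ D n| = 2 * (|Real.sin (Real.pi * n * (2 * D + 3 * κ))| *
      |Real.sin (Real.pi * n * κ)|) / (Real.pi ^ 2 * n ^ 2 * κ) := by
    rw [smoothedSawCoeff, Real.cos_sub_cos, abs_div, abs_of_pos hq]
    congr 1
    rw [show (2 * Real.pi * n * (D + κ) + 2 * Real.pi * n * (D + 2 * κ)) / 2
        = Real.pi * n * (2 * D + 3 * κ) by ring,
      show (2 * Real.pi * n * (D + κ) - 2 * Real.pi * n * (D + 2 * κ)) / 2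
        = - (Real.pi * n * κ) by ring, Real.sin_neg, abs_mul, abs_mul, abs_neg]
    norm_num [mul_assoc]
  rw [e]
  have h0 := abs_nonneg (Real.sin (Real.pi * n * (2 * D + 3 * κ)))
  have h0' := abs_nonneg (Real.sin (Real.pi * n * κ))
  refine ⟨?_, ?_, ?_⟩
  · rw [div_le_iff₀ hq]
    have := mul_le_mul ht hs h0' (by positivity)
    nlinarith [this]
  · rw [div_le_iff₀ hq]
    have := mul_le_mul ht1 hs h0' (by positivity)
    have e2 : 1 / (n : ℝ) * (Real.pi ^ 2 * n ^ 2 * κ) = Real.pi * (Real.pi * n * κ) := by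
      field_simp
    rw [e2]
    have : 0 < Real.pi * n * κ := by positivity
    nlinarith
  · have e3 : 1 / (κ * (n : ℝ) ^ 2) = Real.pi ^ 2 / (Real.pi ^ 2 * n ^ 2 * κ) := by
      field_simp
    rw [e3]
    gcongr
    have := mul_le_mul ht1 hs1 h0' (by positivity)
    nlinarith

/-- A trigonometric majorant of `x ↦ psiSaw (x - D) - psiSaw (x + D)`, stable under perturbing the
argument by at most `κ`. -/
lemma exists_trig_majorant {κ : ℝ} (hκ : 0 < κ) (D : ℝ) :
    ∃ (K : ℕ) (a : ℕ → ℝ),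
      (∀ n, |a n| ≤ 4 * |D| + 6 * κ ∧ |a n| ≤ 1 / n ∧ |a n| ≤ 1 / (κ * n ^ 2)) ∧
      ∀ x u, 0 ≤ u → u ≤ κ → psiSaw (x - D) - psiSaw (x + D) ≤
        ∑ n ∈ Finset.Icc 1 K, a n * Real.cos (2 * Real.pi * n * (x + u)) + 5 * κ := by
  have hsum : Summable (fun n : ℕ => 1 / (κ * (n : ℝ) ^ 2)) := by
    have := (Real.summable_one_div_nat_pow (p := 2)).mpr (by norm_num)
    refine (this.mul_left (1 / κ)).congr fun n => ?_
    rw [one_div_mul_one_div]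
  have htend := tendsto_sum_nat_add (fun n : ℕ => 1 / (κ * (n : ℝ) ^ 2))
  obtain ⟨K, hK⟩ := (htend.eventually (gt_mem_nhds hκ)).exists
  refine ⟨K, smoothedSawCoeff κ D, abs_smoothedSawCoeff_le hκ D, fun x u hu huκ => ?_⟩
  refine (psiSaw_sub_le_smoothedSaw hκ D x u hu huκ).trans ?_
  have hS := hasSum_smoothedSaw hκ D (x + u)
  have hb : ∀ n : ℕ, |smoothedSawCoeff κ D n * Real.cos (2 * Real.pi * n * (x + u))|
      ≤ 1 / (κ * (n : ℝ) ^ 2) := fun n => by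
    rw [abs_mul]
    exact (mul_le_of_le_one_right (abs_nonneg _) (Real.abs_cos_le_one _)).trans
      (abs_smoothedSawCoeff_le hκ D n).2.2
  have htail : ∑' n : ℕ, smoothedSawCoeff κ D (n + (K + 1)) *
      Real.cos (2 * Real.pi * (n + (K + 1) : ℕ) * (x + u)) ≤
      ∑' n : ℕ, 1 / (κ * ((n + K : ℕ) : ℝ) ^ 2) := by
    have h1 : Summable (fun n : ℕ => 1 / (κ * ((n + K : ℕ) : ℝ) ^ 2)) :=
      (summable_nat_add_iff (f := fun n : ℕ => 1 / (κ * (n : ℝ) ^ 2)) K).mpr hsum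
    have h2 : Summable (fun n : ℕ => 1 / (κ * ((n + (K + 1) : ℕ) : ℝ) ^ 2)) :=
      (summable_nat_add_iff (f := fun n : ℕ => 1 / (κ * (n : ℝ) ^ 2)) (K + 1)).mpr hsum
    have h3 := (summable_nat_add_iff (f := fun n : ℕ => smoothedSawCoeff κ D n *
      Real.cos (2 * Real.pi * n * (x + u))) (K + 1)).mpr hS.summable
    refine (h3.tsum_le_tsum (fun n => (le_abs_self _).trans (hb _)) h2).trans ?_
    have h4 := h1.tsum_eq_zero_add
    have h5 : (0 : ℝ) ≤ 1 / (κ * ((0 + K : ℕ) : ℝ) ^ 2) := by positivity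
    have h6 : (fun n : ℕ => 1 / (κ * ((n + 1 + K : ℕ) : ℝ) ^ 2)) =
        fun n : ℕ => 1 / (κ * ((n + (K + 1) : ℕ) : ℝ) ^ 2) := by
      ext n
      rw [show n + 1 + K = n + (K + 1) by ring]
    rw [h6] at h4
    linarith
  have hsplit := hS.summable.sum_add_tsum_nat_add (K + 1)
  rw [hS.tsum_eq] at hsplit
  have hzero : ∑ n ∈ Finset.range (K + 1), smoothedSawCoeff κ D n *
      Real.cos (2 * Real.pi * n * (x + u)) = ∑ n ∈ Finset.Icc 1 K, smoothedSawCoeff κ D n *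
      Real.cos (2 * Real.pi * n * (x + u)) := by
    symm
    apply Finset.sum_subset
    · intro n hn
      simp at hn ⊢
      omega
    · intro n hn hn'
      have : n = 0 := by
        simp at hn hn'
        omega
      simp [this, smoothedSawCoeff]
  linarith

lemma sum_Icc_one_div_one_add_sq_le {M : ℝ} (hM : 0 < M) (J : ℕ) :
    ∑ j ∈ Finset.Icc (-(J : ℤ)) J, 1 / (1 + ((j : ℝ) / M) ^ 2) ≤ 1 + 4 * M := by
  suffices h : ∑ j ∈ Finset.Icc (-(J : ℤ)) J, 1 / (1 + ((j : ℝ) / M) ^ 2)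
      ≤ 1 + 4 * M - 4 * M ^ 2 / (M + J) by
    have : 0 ≤ 4 * M ^ 2 / (M + J) := by positivity
    linarith
  induction J with
  | zero =>
    have : 4 * M ^ 2 / M = 4 * M := by field_simp
    simp [this]
  | succ J ih =>
    have hset : Finset.Icc (-((J + 1 : ℕ) : ℤ)) ((J + 1 : ℕ) : ℤ) =
        insert (-((J : ℤ) + 1)) (insert ((J : ℤ) + 1) (Finset.Icc (-(J : ℤ)) J)) := by
      ext x
      simp only [Finset.mem_insert, Finset.mem_Icc]
      push_cast
      omega
    rw [hset, Finset.sum_insert, Finset.sum_insert]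
    · have e : 1 / (1 + (((J : ℝ) + 1) / M) ^ 2) ≤ 2 * M ^ 2 / (M + J) - 2 * M ^ 2 / (M + J + 1) := by
        have h1 : 2 * M ^ 2 / (M + J) - 2 * M ^ 2 / (M + J + 1)
            = 2 * M ^ 2 / ((M + J) * (M + J + 1)) := by
          field_simp
          ring
        have h2 : 1 / (1 + (((J : ℝ) + 1) / M) ^ 2) = M ^ 2 / (M ^ 2 + (J + 1) ^ 2) := by
          field_simp
        rw [h1, h2, div_le_div_iff₀ (by positivity) (by positivity)]
        have : (M + J) * (M + J + 1) ≤ 2 * (M ^ 2 + ((J : ℝ) + 1) ^ 2) := by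
          nlinarith [sq_nonneg (M - (J + 1)), hM]
        nlinarith [sq_nonneg M]
      have e3 : 4 * M ^ 2 / (M + J) = 2 * (2 * M ^ 2 / (M + J)) := by ring
      have e4 : 4 * M ^ 2 / (M + (J + 1)) = 2 * (2 * M ^ 2 / (M + J + 1)) := by ring
      push_cast
      rw [show (-((J : ℝ) + 1) / M) ^ 2 = (((J : ℝ) + 1) / M) ^ 2 by ring, e4]
      rw [e3] at ih
      linarith
    · simp
    · simp
      omega

lemma card_le_of_pairwise_modEq {N r : ℕ} (S : Finset ℕ)
    (hS : S ⊆ Finset.Icc (N + 1) (2 * N)) (h : ∀ x ∈ S, ∀ y ∈ S, x ≡ y [MOD r]) :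
    (S.card : ℝ) ≤ N / r + 1 := by
  have hcard : S.card ≤ (Finset.range (N / r + 1)).card := by
    apply Finset.card_le_card_of_injOn (fun x => (x - (N + 1)) / r)
    · intro x hx
      have := Finset.mem_Icc.mp (hS hx)
      simp only [Finset.coe_range, Set.mem_Iio]
      exact Nat.lt_succ_of_le (Nat.div_le_div_right (by omega))
    · intro x hx y hy hxy
      have hx' := Finset.mem_Icc.mp (hS hx)
      have hy' := Finset.mem_Icc.mp (hS hy)
      have hmod : (x - (N + 1)) ≡ (y - (N + 1)) [MOD r] := by
        have := h x hx y hy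
        rw [← Nat.sub_add_cancel hx'.1, ← Nat.sub_add_cancel hy'.1] at this
        exact Nat.ModEq.add_right_cancel' _ this
      have e1 := Nat.div_add_mod (x - (N + 1)) r
      have e2 := Nat.div_add_mod (y - (N + 1)) r
      simp only at hxy
      unfold Nat.ModEq at hmod
      rw [hxy, hmod] at e1
      omega
  rw [Finset.card_range] at hcard
  have h1 : (S.card : ℝ) ≤ ((N / r : ℕ) : ℝ) + 1 := by exact_mod_cast hcard
  exact h1.trans (by gcongr; exact Nat.cast_div_le)

lemma card_filter_sq_mul_sub_eq_le {N p q : ℕ} (hp : 0 < p) (hpq : Nat.Coprime p q) (j : ℤ) :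
    (((Finset.Icc (N + 1) (2 * N) ×ˢ Finset.Icc (N + 1) (2 * N)).filter
      (fun x => (p : ℤ) ^ 2 * x.1 - (q : ℤ) ^ 2 * x.2 = j)).card : ℝ) ≤ N / (p ^ 2 : ℕ) + 1 := by
  set S := (Finset.Icc (N + 1) (2 * N) ×ˢ Finset.Icc (N + 1) (2 * N)).filter
      (fun x => (p : ℤ) ^ 2 * x.1 - (q : ℤ) ^ 2 * x.2 = j) with hS
  have hp2 : ((p : ℤ) ^ 2) ≠ 0 := by positivity
  have hinj : Set.InjOn Prod.snd (S : Set (ℕ × ℕ)) := by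
    rintro ⟨a, b⟩ hx ⟨c, e⟩ hy hxy
    simp only [hS, Finset.coe_filter, Set.mem_ofPred_eq] at hx hy hxy
    subst hxy
    have : (p : ℤ) ^ 2 * a = (p : ℤ) ^ 2 * c := by linarith [hx.2, hy.2]
    have := mul_left_cancel₀ hp2 this
    have : a = c := by exact_mod_cast this
    rw [this]
  rw [← Finset.card_image_of_injOn hinj]
  apply card_le_of_pairwise_modEq
  · intro b hb
    obtain ⟨x, hx, rfl⟩ := Finset.mem_image.mp hb
    exact (Finset.mem_product.mp (Finset.mem_filter.mp hx).1).2
  · intro b hb c hc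
    obtain ⟨x, hx, rfl⟩ := Finset.mem_image.mp hb
    obtain ⟨y, hy, rfl⟩ := Finset.mem_image.mp hc
    have hx2 := (Finset.mem_filter.mp hx).2
    have hy2 := (Finset.mem_filter.mp hy).2
    rw [← Int.natCast_modEq_iff, Int.modEq_iff_dvd]
    have hc : IsCoprime (((p ^ 2 : ℕ) : ℤ)) ((q : ℤ) ^ 2) := by
      have := Nat.isCoprime_iff_coprime.mpr (hpq.pow 2 2)
      push_cast at this ⊢
      exact this
    apply hc.dvd_of_dvd_mul_left
    refine ⟨(y.1 : ℤ) - x.1, ?_⟩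
    push_cast
    linarith

/-- The weighted number of `b, b' ∈ (N, 2N]` for which `h² b` and `h'² b'` are close. -/
noncomputable def closePairWeight (N d h h' : ℕ) : ℝ :=
  ∑ b ∈ Finset.Icc (N + 1) (2 * N), ∑ b' ∈ Finset.Icc (N + 1) (2 * N),
    1 / (1 + (((h : ℝ) ^ 2 * b - (h' : ℝ) ^ 2 * b') / (d * (h + h'))) ^ 2)

lemma closePairWeight_comm (N d h h' : ℕ) :
    closePairWeight N d h h' = closePairWeight N d h' h := by
  unfold closePairWeight
  rw [Finset.sum_comm]
  refine Finset.sum_congr rfl fun b _ => Finset.sum_congr rfl fun b' _ => ?_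
  rw [add_comm (h' : ℝ) h, ← neg_sq, ← neg_div, neg_sub]

lemma closePairWeight_le_sq (N d h h' : ℕ) : closePairWeight N d h h' ≤ (N : ℝ) ^ 2 := by
  unfold closePairWeight
  have : ∀ b ∈ Finset.Icc (N + 1) (2 * N), ∑ b' ∈ Finset.Icc (N + 1) (2 * N),
      1 / (1 + (((h : ℝ) ^ 2 * b - (h' : ℝ) ^ 2 * b') / (d * (h + h'))) ^ 2) ≤ (N : ℝ) := by
    intro b _
    have : ∀ b' ∈ Finset.Icc (N + 1) (2 * N),
        1 / (1 + (((h : ℝ) ^ 2 * b - (h' : ℝ) ^ 2 * b') / (d * (h + h'))) ^ 2) ≤ 1 := by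
      intro b' _
      rw [div_le_one (by positivity)]
      linarith [sq_nonneg (((h : ℝ) ^ 2 * b - (h' : ℝ) ^ 2 * b') / (d * (h + h')))]
    refine (Finset.sum_le_card_nsmul _ _ _ this).trans ?_
    simp
    omega
  refine (Finset.sum_le_card_nsmul _ _ _ this).trans ?_
  simp
  rw [show 2 * N - N = N by omega, sq]

lemma closePairWeight_le_mul {N d h h' : ℕ} (hd : 0 < d) (hh : 0 < h) :
    closePairWeight N d h h' ≤ (N * (Nat.gcd h h' : ℝ) ^ 2 / h ^ 2 + 1) *
      (1 + 4 * (d * (h + h') / (Nat.gcd h h' : ℝ) ^ 2)) := by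
  set g := Nat.gcd h h' with hg
  have hg0 : 0 < g := Nat.gcd_pos_of_pos_left _ hh
  obtain ⟨p, hp⟩ : g ∣ h := Nat.gcd_dvd_left _ _
  obtain ⟨q, hq⟩ : g ∣ h' := Nat.gcd_dvd_right _ _
  have hp0 : 0 < p := Nat.pos_of_ne_zero (by rintro rfl; simp at hp; omega)
  have hpq : Nat.Coprime p q := by
    have : g * Nat.gcd p q = g * 1 := by
      rw [← Nat.gcd_mul_left, ← hp, ← hq, mul_one]
    exact Nat.eq_of_mul_eq_mul_left hg0 this
  have hgr : (0 : ℝ) < g := by exact_mod_cast hg0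
  have hdr : (0 : ℝ) < d := by exact_mod_cast hd
  have hhr : (0 : ℝ) < h := by exact_mod_cast hh
  set M : ℝ := d * (h + h') / (g : ℝ) ^ 2 with hM
  have hM0 : 0 < M := by positivity
  set S := Finset.Icc (N + 1) (2 * N) ×ˢ Finset.Icc (N + 1) (2 * N)
  set f : ℕ × ℕ → ℤ := fun x => (p : ℤ) ^ 2 * x.1 - (q : ℤ) ^ 2 * x.2 with hf
  have h1 : closePairWeight N d h h' = ∑ x ∈ S, (fun j : ℤ => (1 : ℝ) / (1 + ((j : ℝ) / M) ^ 2)) (f x) := by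
    unfold closePairWeight
    rw [← Finset.sum_product']
    refine Finset.sum_congr rfl fun x _ => ?_
    have hhe : (h : ℝ) = g * p := by exact_mod_cast hp
    have hhe' : (h' : ℝ) = g * q := by exact_mod_cast hq
    have : ((h : ℝ) ^ 2 * x.1 - (h' : ℝ) ^ 2 * x.2) / (d * (h + h')) = (f x : ℝ) / M := by
      have hne : (d : ℝ) * (h + h') ≠ 0 := by positivity
      rw [hM, div_div_eq_mul_div]
      congr 1
      simp only [hf]
      push_cast
      rw [hhe, hhe']
      ring
    simp only [this]
  refine (h1.trans (Finset.sum_comp (fun j : ℤ => (1 : ℝ) / (1 + ((j : ℝ) / M) ^ 2)) f)).le.trans ?_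
  have hc : (N * (g : ℝ) ^ 2 / h ^ 2 + 1) = N / (p ^ 2 : ℕ) + 1 := by
    have hpr : (0 : ℝ) < p := by exact_mod_cast hp0
    have hhe : (h : ℝ) = g * p := by exact_mod_cast hp
    rw [hhe]
    push_cast
    field_simp
  rw [hc]
  obtain ⟨J, hJ⟩ : ∃ J : ℕ, Finset.image f S ⊆ Finset.Icc (-(J : ℤ)) J := by
    refine ⟨(Finset.image f S).sup Int.natAbs, fun j hj => ?_⟩
    have : j.natAbs ≤ (Finset.image f S).sup Int.natAbs := Finset.le_sup (f := Int.natAbs) hj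
    rw [Finset.mem_Icc]
    omega
  have hfiber : ∀ j ∈ Finset.image f S,
      (S.filter (fun x => f x = j)).card • (1 / (1 + ((j : ℝ) / M) ^ 2)) ≤
        ((N : ℝ) / (p ^ 2 : ℕ) + 1) * (1 / (1 + ((j : ℝ) / M) ^ 2)) := by
    intro j _
    rw [nsmul_eq_mul]
    exact mul_le_mul_of_nonneg_right (card_filter_sq_mul_sub_eq_le hp0 hpq j) (by positivity)
  refine (Finset.sum_le_sum hfiber).trans ?_
  calc ∑ j ∈ Finset.image f S, ((N : ℝ) / (p ^ 2 : ℕ) + 1) * (1 / (1 + ((j : ℝ) / M) ^ 2))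
      ≤ ∑ j ∈ Finset.Icc (-(J : ℤ)) J,
          ((N : ℝ) / (p ^ 2 : ℕ) + 1) * (1 / (1 + ((j : ℝ) / M) ^ 2)) :=
        Finset.sum_le_sum_of_subset_of_nonneg hJ fun _ _ _ => by positivity
    _ ≤ _ := by
        rw [← Finset.mul_sum]
        exact mul_le_mul_of_nonneg_left (sum_Icc_one_div_one_add_sq_le hM0 J) (by positivity)

lemma closePairWeight_le {N d h h' : ℕ} (hd : 0 < d) (hh : 0 < h) (hh' : 0 < h') :
    closePairWeight N d h h' ≤ N * (Nat.gcd h h' : ℝ) ^ 2 / (h * h') +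
      8 * N * d / Real.sqrt (h * h') + 1 + min ((N : ℝ) ^ 2) (4 * d * (h + h')) := by
  wlog hle : h' ≤ h generalizing h h'
  · have := this hh' hh (by omega)
    rwa [closePairWeight_comm, Nat.gcd_comm, mul_comm (h' : ℝ), add_comm (h' : ℝ)] at this
  have hhr : (1 : ℝ) ≤ h := by exact_mod_cast hh
  have hhr' : (1 : ℝ) ≤ h' := by exact_mod_cast hh'
  have hler : (h' : ℝ) ≤ h := by exact_mod_cast hle
  have hdr : (0 : ℝ) < d := by exact_mod_cast hd
  have hs : Real.sqrt (h * h') ≤ h := by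
    rw [Real.sqrt_le_left (by linarith), sq]
    gcongr
  have hs0 : 0 < Real.sqrt (h * h') := Real.sqrt_pos.mpr (by positivity)
  rcases le_total ((N : ℝ) ^ 2) (4 * d * (h + h')) with hmin | hmin
  · rw [min_eq_left hmin]
    have := closePairWeight_le_sq N d h h'
    have : 0 ≤ N * (Nat.gcd h h' : ℝ) ^ 2 / (h * h') + 8 * N * d / Real.sqrt (h * h') := by
      positivity
    linarith
  · rw [min_eq_right hmin]
    refine (closePairWeight_le_mul hd hh).trans ?_
    have hg : (1 : ℝ) ≤ (Nat.gcd h h' : ℕ) := by exact_mod_cast Nat.gcd_pos_of_pos_left _ hh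
    set g : ℝ := ((Nat.gcd h h' : ℕ) : ℝ)
    have e1 : N * g ^ 2 / h ^ 2 ≤ N * g ^ 2 / (h * h') := by
      rw [sq (h : ℝ)]
      gcongr
    have e2 : N * g ^ 2 / h ^ 2 * (4 * (d * (h + h') / g ^ 2)) ≤ 8 * N * d / Real.sqrt (h * h') := by
      calc N * g ^ 2 / h ^ 2 * (4 * (d * (h + h') / g ^ 2)) = 4 * (N : ℝ) * d * (h + h') / (h : ℝ) ^ 2 := by
            field_simp
        _ ≤ 4 * (N : ℝ) * d * (h + h) / (h : ℝ) ^ 2 := by gcongr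
        _ = 8 * (N : ℝ) * d / h := by
            field_simp
            ring
        _ ≤ _ := by gcongr
    have e3 : 4 * (d * (h + h') / g ^ 2) ≤ 4 * d * (h + h') := by
      rw [mul_assoc 4 (d : ℝ)]
      gcongr
      exact div_le_self (by positivity) (by nlinarith)
    calc (N * g ^ 2 / h ^ 2 + 1) * (1 + 4 * (d * (h + h') / g ^ 2))
        = N * g ^ 2 / h ^ 2 + N * g ^ 2 / h ^ 2 * (4 * (d * (h + h') / g ^ 2)) + 1
          + 4 * (d * (h + h') / g ^ 2) := by ring
      _ ≤ _ := by linarith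

lemma integral_sub_mul_cos_le {T : ℝ} (y : ℝ) :
    |∫ t in (0 : ℝ)..T, (T - t) * Real.cos (y * t)| ≤ T ^ 2 / (1 + (T * y) ^ 2 / 4) := by
  rcases eq_or_ne y 0 with rfl | hy
  · have : ∫ t in (0 : ℝ)..T, (T - t) * Real.cos (0 * t) = T ^ 2 / 2 := by
      simp only [zero_mul, Real.cos_zero, mul_one]
      rw [intervalIntegral.integral_sub (Continuous.intervalIntegrable (by fun_prop) _ _)
        (Continuous.intervalIntegrable (by fun_prop) _ _), integral_id]
      simp
      ring
    rw [this, abs_of_nonneg (by positivity)]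
    simp
    linarith [sq_nonneg T]
  · have hintg : ∫ t in (0 : ℝ)..T, (T - t) * Real.cos (y * t) = (1 - Real.cos (y * T)) / y ^ 2 := by
      have hderiv : ∀ t ∈ Set.uIcc 0 T,
          HasDerivAt (fun t => (T - t) * Real.sin (y * t) / y - Real.cos (y * t) / y ^ 2)
            ((T - t) * Real.cos (y * t)) t := by
        intro t _
        have hl : HasDerivAt (fun t : ℝ => y * t) y t := by
          simpa using (hasDerivAt_id t).const_mul y
        have h1 := ((((hasDerivAt_id t).const_sub T).mul hl.sin).div_const y).sub
          (hl.cos.div_const (y ^ 2))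
        convert! h1 using 1
        simp
        field_simp
        ring
      rw [intervalIntegral.integral_eq_sub_of_hasDerivAt hderiv
        (Continuous.intervalIntegrable (by fun_prop) _ _)]
      simp
      ring
    rw [hintg]
    have hc1 := Real.cos_le_one (y * T)
    have hc2 := Real.neg_one_le_cos (y * T)
    have hc3 := Real.one_sub_sq_div_two_le_cos (x := y * T)
    have hy2 : 0 < y ^ 2 := by positivity
    rw [abs_of_nonneg (div_nonneg (by linarith) hy2.le), div_le_div_iff₀ hy2 (by positivity)]
    nlinarith [sq_nonneg (T * y)]

lemma integral_sub_mul_sq_cos_sum_le {ι : Type*} (S : Finset ι) (c ω : ι → ℝ)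
    (hω : ∀ i, 0 ≤ ω i) (T : ℝ) :
    ∫ t in (0 : ℝ)..T, (T - t) * (∑ i ∈ S, c i * Real.cos (ω i * t)) ^ 2 ≤
      ∑ i ∈ S, ∑ j ∈ S, |c i| * |c j| * (T ^ 2 / (1 + (T * (ω i - ω j)) ^ 2 / 4)) := by
  have hexp : ∀ t : ℝ, (T - t) * (∑ i ∈ S, c i * Real.cos (ω i * t)) ^ 2 =
      ∑ i ∈ S, ∑ j ∈ S, c i * c j / 2 * ((T - t) * Real.cos ((ω i - ω j) * t) +
        (T - t) * Real.cos ((ω i + ω j) * t)) := by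
    intro t
    rw [sq, Finset.sum_mul_sum, Finset.mul_sum]
    refine Finset.sum_congr rfl fun i _ => ?_
    rw [Finset.mul_sum]
    refine Finset.sum_congr rfl fun j _ => ?_
    rw [sub_mul (ω i), add_mul (ω i), Real.cos_sub, Real.cos_add]
    ring
  simp_rw [hexp]
  rw [intervalIntegral.integral_finsetSum
    (fun i _ => Continuous.intervalIntegrable (by fun_prop) _ _)]
  refine Finset.sum_le_sum fun i _ => ?_
  rw [intervalIntegral.integral_finsetSum
    (fun i _ => Continuous.intervalIntegrable (by fun_prop) _ _)]
  refine Finset.sum_le_sum fun j _ => ?_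
  rw [intervalIntegral.integral_const_mul, intervalIntegral.integral_add
    (Continuous.intervalIntegrable (by fun_prop) _ _)
    (Continuous.intervalIntegrable (by fun_prop) _ _)]
  have h1 := integral_sub_mul_cos_le (T := T) (ω i - ω j)
  have h2 := integral_sub_mul_cos_le (T := T) (ω i + ω j)
  have h3 : T ^ 2 / (1 + (T * (ω i + ω j)) ^ 2 / 4) ≤ T ^ 2 / (1 + (T * (ω i - ω j)) ^ 2 / 4) := by
    have : (ω i - ω j) ^ 2 ≤ (ω i + ω j) ^ 2 := by nlinarith [mul_nonneg (hω i) (hω j)]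
    rw [mul_pow, mul_pow]
    gcongr
  set I₁ := ∫ t in (0 : ℝ)..T, (T - t) * Real.cos ((ω i - ω j) * t)
  set I₂ := ∫ t in (0 : ℝ)..T, (T - t) * Real.cos ((ω i + ω j) * t)
  set R := T ^ 2 / (1 + (T * (ω i - ω j)) ^ 2 / 4)
  calc c i * c j / 2 * (I₁ + I₂) ≤ |c i * c j / 2 * (I₁ + I₂)| := le_abs_self _
    _ = |c i| * |c j| / 2 * |I₁ + I₂| := by
        rw [abs_mul, abs_div, abs_mul]
        norm_num
    _ ≤ |c i| * |c j| / 2 * (R + R) := by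
        gcongr
        exact (abs_add_le _ _).trans (add_le_add h1 (h2.trans h3))
    _ = _ := by ring

/-- The mean square of `t ↦ ∑ b, ∑ k, a k cos (2π k t √b / d)` over the range of `√a`. -/
lemma integral_sq_trig_sum_le {N d : ℕ} (hN : 0 < N) (hd : 0 < d) (B : Finset ℕ)
    (hB : B ⊆ Finset.Icc (N + 1) (2 * N)) (K : ℕ) (a : ℕ → ℝ) :
    ∫ t in Real.sqrt (N + 1 : ℕ)..Real.sqrt (2 * N + 1 : ℕ),
      (∑ b ∈ B, ∑ k ∈ Finset.Icc 1 K,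
        a k * Real.cos (2 * Real.pi * k * (t * Real.sqrt b / d))) ^ 2 ≤
    8 * Real.sqrt N * ∑ h ∈ Finset.Icc 1 K, ∑ h' ∈ Finset.Icc 1 K,
      |a h| * |a h'| * closePairWeight N d h h' := by
  have hNr : (1 : ℝ) ≤ N := by exact_mod_cast hN
  have hdr : (0 : ℝ) < d := by exact_mod_cast hd
  set T : ℝ := 4 * Real.sqrt N with hT
  have hsN : 0 < Real.sqrt N := Real.sqrt_pos.mpr (by linarith)
  have hT0 : 0 < T := by positivity
  set ω : ℕ × ℕ → ℝ := fun x => 2 * Real.pi * x.1 * Real.sqrt x.2 / d with hω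
  set S := Finset.Icc 1 K ×ˢ B with hS
  set F : ℝ → ℝ := fun t => ∑ x ∈ S, a x.1 * Real.cos (ω x * t) with hF
  have hFc : Continuous F := by
    simp only [hF]
    fun_prop
  have hFeq : ∀ t : ℝ, ∑ b ∈ B, ∑ k ∈ Finset.Icc 1 K,
      a k * Real.cos (2 * Real.pi * k * (t * Real.sqrt b / d)) = F t := by
    intro t
    simp only [hF, hS]
    rw [Finset.sum_product_right]
    refine Finset.sum_congr rfl fun b _ => Finset.sum_congr rfl fun k _ => ?_
    congr 2
    simp only [hω]
    ring
  simp_rw [hFeq]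
  have hr1 : Real.sqrt (N + 1 : ℕ) ≤ Real.sqrt (2 * N + 1 : ℕ) :=
    Real.sqrt_le_sqrt (by push_cast; linarith)
  have hr2 : Real.sqrt (2 * N + 1 : ℕ) ≤ T / 2 := by
    rw [Real.sqrt_le_left (by positivity), hT]
    push_cast
    have := Real.sq_sqrt (show (0 : ℝ) ≤ N by linarith)
    nlinarith
  have hexpand : ∫ t in Real.sqrt (N + 1 : ℕ)..Real.sqrt (2 * N + 1 : ℕ), F t ^ 2 ≤
      ∫ t in (0 : ℝ)..T, 2 / T * ((T - t) * F t ^ 2) := by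
    have hpt : ∀ t ∈ Set.Icc (Real.sqrt (N + 1 : ℕ)) (Real.sqrt (2 * N + 1 : ℕ)),
        F t ^ 2 ≤ 2 / T * ((T - t) * F t ^ 2) := by
      intro t ht
      have : 1 ≤ 2 / T * (T - t) := by
        rw [div_mul_eq_mul_div, le_div_iff₀ hT0]
        linarith [ht.2]
      nlinarith [sq_nonneg (F t)]
    refine (intervalIntegral.integral_mono_on hr1
      (Continuous.intervalIntegrable (by fun_prop) _ _)
      (Continuous.intervalIntegrable (by fun_prop) _ _) hpt).trans ?_
    refine intervalIntegral.integral_mono_interval (Real.sqrt_nonneg _) hr1 (by linarith) ?_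
      (Continuous.intervalIntegrable (by fun_prop) _ _)
    refine (MeasureTheory.ae_restrict_iff' measurableSet_Ioc).mpr (Filter.Eventually.of_forall ?_)
    intro t ht
    have : 0 ≤ T - t := by linarith [ht.2]
    simp only [Pi.zero_apply]
    positivity
  refine hexpand.trans ?_
  rw [intervalIntegral.integral_const_mul]
  have hω0 : ∀ x, 0 ≤ ω x := fun x => by
    simp only [hω]
    positivity
  have hshift := integral_sub_mul_sq_cos_sum_le S (fun x => a x.1) ω hω0 T
  have hterm : ∀ h ∈ Finset.Icc 1 K, ∀ h' ∈ Finset.Icc 1 K, ∀ b ∈ B, ∀ b' ∈ B,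
      T ^ 2 / (1 + (T * (ω (h, b) - ω (h', b'))) ^ 2 / 4) ≤ T ^ 2 *
      (1 / (1 + (((h : ℝ) ^ 2 * b - (h' : ℝ) ^ 2 * b') / (d * (h + h'))) ^ 2)) := by
    intro h hh h' _ b hb b' hb'
    rw [mul_one_div]
    have hh1 : (1 : ℝ) ≤ h := by exact_mod_cast (Finset.mem_Icc.mp hh).1
    have hb2 : (b : ℝ) ≤ 2 * N := by exact_mod_cast (Finset.mem_Icc.mp (hB hb)).2
    have hb2' : (b' : ℝ) ≤ 2 * N := by exact_mod_cast (Finset.mem_Icc.mp (hB hb')).2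
    have hsb := Real.sqrt_le_sqrt hb2
    have hsb' := Real.sqrt_le_sqrt hb2'
    have hfac : ((h : ℝ) ^ 2 * b - (h' : ℝ) ^ 2 * b') =
        (h * Real.sqrt b - h' * Real.sqrt b') * (h * Real.sqrt b + h' * Real.sqrt b') := by
      have e1 := Real.sq_sqrt (Nat.cast_nonneg (α := ℝ) b)
      have e2 := Real.sq_sqrt (Nat.cast_nonneg (α := ℝ) b')
      linear_combination (-(h : ℝ) ^ 2) * e1 + (h' : ℝ) ^ 2 * e2
    have hle : h * Real.sqrt b + h' * Real.sqrt b' ≤ (h + h') * Real.sqrt (2 * N) := by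
      rw [add_mul]
      gcongr
    have hw : ω (h, b) - ω (h', b') =
        2 * Real.pi * ((h * Real.sqrt b - h' * Real.sqrt b') / d) := by
      simp only [hω]
      ring
    set u := (h * Real.sqrt b - h' * Real.sqrt b') / d with hu
    have e : (((h : ℝ) ^ 2 * b - (h' : ℝ) ^ 2 * b') / (d * (h + h'))) =
        u * ((h * Real.sqrt b + h' * Real.sqrt b') / (h + h')) := by
      rw [hfac, hu]
      have : (h : ℝ) + h' ≠ 0 := by positivity
      field_simp
    have hv : ((h * Real.sqrt b + h' * Real.sqrt b') / (h + h')) ^ 2 ≤ 2 * N := by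
      have h0 : (h * Real.sqrt b + h' * Real.sqrt b') / (h + h') ≤ Real.sqrt (2 * N) := by
        rw [div_le_iff₀ (by positivity)]
        linarith
      calc _ ≤ Real.sqrt (2 * N) ^ 2 := by gcongr
        _ = 2 * N := Real.sq_sqrt (by positivity)
    have hT2 : T ^ 2 = 16 * N := by
      rw [hT, mul_pow, Real.sq_sqrt (by linarith)]
      norm_num
    have hkey : (u * ((h * Real.sqrt b + h' * Real.sqrt b') / (h + h'))) ^ 2 ≤
        (T * (2 * Real.pi * u)) ^ 2 / 4 := by
      have hpi : 1 ≤ Real.pi ^ 2 := by nlinarith [Real.pi_gt_three]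
      calc _ = u ^ 2 * ((h * Real.sqrt b + h' * Real.sqrt b') / (h + h')) ^ 2 := by ring
        _ ≤ u ^ 2 * (2 * N) := by gcongr
        _ ≤ u ^ 2 * (16 * N * Real.pi ^ 2) := by
            refine mul_le_mul_of_nonneg_left ?_ (sq_nonneg u)
            nlinarith
        _ = _ := by
            rw [mul_pow, hT2]
            ring
    rw [e, hw]
    gcongr
  have hdiff : ∑ i ∈ S, ∑ j ∈ S, |a i.1| * |a j.1| * (T ^ 2 / (1 + (T * (ω i - ω j)) ^ 2 / 4)) ≤
      T ^ 2 * ∑ h ∈ Finset.Icc 1 K, ∑ h' ∈ Finset.Icc 1 K,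
        |a h| * |a h'| * closePairWeight N d h h' := by
    rw [hS, Finset.sum_product, Finset.mul_sum]
    refine Finset.sum_le_sum fun h hh => ?_
    simp_rw [Finset.sum_product]
    rw [Finset.sum_comm, Finset.mul_sum]
    refine Finset.sum_le_sum fun h' hh' => ?_
    calc _ ≤ ∑ b ∈ B, ∑ b' ∈ B, T ^ 2 * (|a h| * |a h'|) *
          (1 / (1 + (((h : ℝ) ^ 2 * b - (h' : ℝ) ^ 2 * b') / (d * (h + h'))) ^ 2)) := by
          refine Finset.sum_le_sum fun b hb => Finset.sum_le_sum fun b' hb' => ?_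
          calc _ ≤ |a h| * |a h'| * (T ^ 2 *
                (1 / (1 + (((h : ℝ) ^ 2 * b - (h' : ℝ) ^ 2 * b') / (d * (h + h'))) ^ 2))) := by
                exact mul_le_mul_of_nonneg_left (hterm h hh h' hh' b hb b' hb') (by positivity)
            _ = _ := by ring
      _ ≤ ∑ b ∈ Finset.Icc (N + 1) (2 * N), ∑ b' ∈ Finset.Icc (N + 1) (2 * N),
          T ^ 2 * (|a h| * |a h'|) *
          (1 / (1 + (((h : ℝ) ^ 2 * b - (h' : ℝ) ^ 2 * b') / (d * (h + h'))) ^ 2)) := by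
          refine (Finset.sum_le_sum fun b _ => Finset.sum_le_sum_of_subset_of_nonneg hB
            fun _ _ _ => by positivity).trans ?_
          exact Finset.sum_le_sum_of_subset_of_nonneg hB
            fun _ _ _ => Finset.sum_nonneg fun _ _ => by positivity
      _ = _ := by
          unfold closePairWeight
          simp_rw [← Finset.mul_sum]
          ring
  calc _ ≤ 2 / T * (T ^ 2 * ∑ h ∈ Finset.Icc 1 K, ∑ h' ∈ Finset.Icc 1 K,
        |a h| * |a h'| * closePairWeight N d h h') := by
        gcongr
        exact hshift.trans hdiff
    _ = _ := by
        rw [hT]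
        field_simp
        ring

lemma exists_sum_rpow_neg_le {s : ℝ} (hs : 1 < s) :
    ∃ Z : ℝ, 0 < Z ∧ ∀ S : Finset ℕ, ∑ n ∈ S, (n : ℝ) ^ (-s) ≤ Z := by
  have hsum : Summable (fun n : ℕ => (n : ℝ) ^ (-s)) := Real.summable_nat_rpow.mpr (by linarith)
  have h0 : ∀ n : ℕ, 0 ≤ (n : ℝ) ^ (-s) := fun n => by positivity
  have h1 : 0 ≤ ∑' n : ℕ, (n : ℝ) ^ (-s) := tsum_nonneg h0
  refine ⟨∑' n : ℕ, (n : ℝ) ^ (-s) + 1, by linarith, fun S => ?_⟩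
  linarith [hsum.sum_le_tsum S fun n _ => h0 n]

lemma le_rpow_mul_rpow_of_le {α x y s : ℝ} (hα : 0 ≤ α) (hx : α ≤ x) (hy : α ≤ y)
    (hs0 : 0 ≤ s) (hs1 : s ≤ 1) : α ≤ x ^ s * y ^ (1 - s) := by
  rcases hα.eq_or_lt with rfl | h
  · positivity
  · calc α = α ^ s * α ^ (1 - s) := by
          rw [← Real.rpow_add h]
          simp
      _ ≤ _ := by
          have : 0 ≤ 1 - s := by linarith
          have : 0 ≤ x := hα.trans hx
          gcongr

lemma sum_filter_dvd_le {f : ℕ → ℝ} (hf : ∀ n, 0 ≤ f n) (K e : ℕ) (he : 0 < e) :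
    ∑ h ∈ (Finset.Icc 1 K).filter (fun h => e ∣ h), f h ≤ ∑ j ∈ Finset.Icc 1 K, f (e * j) := by
  rw [← Finset.sum_image (f := f) (g := fun j => e * j)
    (fun x _ y _ hxy => Nat.eq_of_mul_eq_mul_left he hxy)]
  refine Finset.sum_le_sum_of_subset_of_nonneg ?_ fun _ _ _ => hf _
  intro h hh
  obtain ⟨hh1, j, rfl⟩ := Finset.mem_filter.mp hh
  rw [Finset.mem_Icc] at hh1
  refine Finset.mem_image.mpr ⟨j, Finset.mem_Icc.mpr ⟨?_, ?_⟩, rfl⟩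
  · exact Nat.pos_of_ne_zero (by rintro rfl; simp at hh1)
  · nlinarith [hh1.2]

lemma sum_mul_gcd_sq_le {g : ℕ → ℝ} (hg : ∀ n, 0 ≤ g n) (K : ℕ) :
    ∑ h ∈ Finset.Icc 1 K, ∑ h' ∈ Finset.Icc 1 K, g h * g h' * (Nat.gcd h h' : ℝ) ^ 2 ≤
      ∑ e ∈ Finset.Icc 1 K, (e : ℝ) ^ 2 *
        (∑ h ∈ (Finset.Icc 1 K).filter (fun h => e ∣ h), g h) ^ 2 := by
  have hgcd : ∀ h ∈ Finset.Icc 1 K, ∀ h' ∈ Finset.Icc 1 K, (Nat.gcd h h' : ℝ) ^ 2 ≤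
      ∑ e ∈ Finset.Icc 1 K, (if e ∣ h then (e : ℝ) else 0) * (if e ∣ h' then (e : ℝ) else 0) := by
    intro h hh h' _
    rw [Finset.mem_Icc] at hh
    have hmem : Nat.gcd h h' ∈ Finset.Icc 1 K := Finset.mem_Icc.mpr
      ⟨Nat.gcd_pos_of_pos_left _ hh.1, (Nat.gcd_le_left _ hh.1).trans hh.2⟩
    have := Finset.single_le_sum (f := fun e : ℕ => (if e ∣ h then (e : ℝ) else 0) *
      (if e ∣ h' then (e : ℝ) else 0)) (fun e _ => by positivity) hmem
    simpa [Nat.gcd_dvd_left, Nat.gcd_dvd_right, sq] using this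
  calc _ ≤ ∑ h ∈ Finset.Icc 1 K, ∑ h' ∈ Finset.Icc 1 K, g h * g h' * ∑ e ∈ Finset.Icc 1 K,
          (if e ∣ h then (e : ℝ) else 0) * (if e ∣ h' then (e : ℝ) else 0) := by
        refine Finset.sum_le_sum fun h hh => Finset.sum_le_sum fun h' hh' => ?_
        exact mul_le_mul_of_nonneg_left (hgcd h hh h' hh') (mul_nonneg (hg h) (hg h'))
    _ = ∑ e ∈ Finset.Icc 1 K, (∑ h ∈ Finset.Icc 1 K, if e ∣ h then e * g h else 0) ^ 2 := by
        simp_rw [sq, Finset.sum_mul_sum, Finset.mul_sum]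
        rw [Finset.sum_comm' (s := Finset.Icc 1 K) (t := fun _ => Finset.Icc 1 K)
          (t' := Finset.Icc 1 K) (s' := fun _ => Finset.Icc 1 K) (by simp)]
        rw [Finset.sum_congr rfl fun h' _ => Finset.sum_comm]
        rw [Finset.sum_comm]
        refine Finset.sum_congr rfl fun e _ => ?_
        rw [Finset.sum_comm]
        refine Finset.sum_congr rfl fun h _ => Finset.sum_congr rfl fun h' _ => ?_
        split_ifs <;> ring
    _ = _ := by
        refine Finset.sum_congr rfl fun e _ => ?_
        rw [← Finset.sum_filter, ← Finset.mul_sum, mul_pow]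

lemma exists_sum_closePairWeight_le {θ : ℝ} (hθ : 0 < θ) (hθ1 : θ ≤ 1 / 4) :
    ∃ C : ℝ, 0 < C ∧ ∀ (N d K : ℕ) (a : ℕ → ℝ) (κ R : ℝ), 0 < d → 0 < κ → 0 < R →
      (∀ n, |a n| ≤ R ∧ |a n| ≤ 1 / n ∧ |a n| ≤ 1 / (κ * n ^ 2)) →
      ∑ h ∈ Finset.Icc 1 K, ∑ h' ∈ Finset.Icc 1 K,
        |a h| * |a h'| * closePairWeight N d h h' ≤
      C * (N * d * R ^ (1 - 2 * θ) + κ ^ (-(2 * θ)) +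
        d * (N : ℝ) ^ (2 * θ) * κ ^ (-(1 + θ))) := by
  obtain ⟨Z, hZ0, hZ⟩ := exists_sum_rpow_neg_le (s := 1 + θ) (by linarith)
  refine ⟨Z ^ 3 + 8 * Z ^ 2, by positivity, fun N d K a κ R hd hκ hR ha => ?_⟩
  have hdr : (1 : ℝ) ≤ d := by exact_mod_cast hd
  set α : ℕ → ℝ := fun h => |a h| with hα
  have hα0 : ∀ h, 0 ≤ α h := fun h => abs_nonneg _
  have hpos : ∀ h ∈ Finset.Icc 1 K, (1 : ℝ) ≤ h := fun h hh => by
    exact_mod_cast (Finset.mem_Icc.mp hh).1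
  have hb1 : ∀ h ∈ Finset.Icc 1 K, α h ≤ R ^ (1 / 2 - θ) * (h : ℝ) ^ (-(1 / 2 + θ)) := by
    intro h hh
    have h1 := hpos h hh
    have := le_rpow_mul_rpow_of_le (hα0 h) (ha h).1 (ha h).2.1 (s := 1 / 2 - θ)
      (by linarith) (by linarith)
    rwa [one_div (h : ℝ), Real.inv_rpow (by linarith), ← Real.rpow_neg (by linarith),
      show -(1 - (1 / 2 - θ)) = -(1 / 2 + θ) by ring] at this
  have hb2 : ∀ h ∈ Finset.Icc 1 K, α h ≤ κ ^ (-θ) * (h : ℝ) ^ (-(1 + θ)) := by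
    intro h hh
    have h1 := hpos h hh
    have := le_rpow_mul_rpow_of_le (hα0 h) (ha h).2.2 (ha h).2.1 (s := θ)
      (by linarith) (by linarith)
    refine this.trans (le_of_eq ?_)
    rw [one_div, one_div, Real.inv_rpow (by positivity), ← Real.rpow_neg (by positivity),
      Real.inv_rpow (by linarith), ← Real.rpow_neg (by linarith),
      Real.mul_rpow hκ.le (by positivity), ← Real.rpow_natCast, ← Real.rpow_mul (by linarith),
      mul_assoc, ← Real.rpow_add (by linarith)]
    congr 2
    push_cast
    ring
  have hb3 : ∀ h ∈ Finset.Icc 1 K, α h * (h : ℝ) ^ (1 - θ) ≤ κ⁻¹ * (h : ℝ) ^ (-(1 + θ)) := by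
    intro h hh
    have h1 := hpos h hh
    calc α h * (h : ℝ) ^ (1 - θ) ≤ 1 / (κ * h ^ 2) * (h : ℝ) ^ (1 - θ) := by
          gcongr
          exact (ha h).2.2
      _ = κ⁻¹ * (h : ℝ) ^ (-(1 + θ)) := by
          rw [show -(1 + θ) = (1 - θ) - (2 : ℕ) by push_cast; ring,
            Real.rpow_sub_natCast (by linarith)]
          field_simp
  have hs1 : ∑ h ∈ Finset.Icc 1 K, α h / Real.sqrt h ≤ R ^ (1 / 2 - θ) * Z := by
    calc _ ≤ ∑ h ∈ Finset.Icc 1 K, R ^ (1 / 2 - θ) * (h : ℝ) ^ (-(1 + θ)) := by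
          refine Finset.sum_le_sum fun h hh => ?_
          have h1 := hpos h hh
          rw [div_le_iff₀ (Real.sqrt_pos.mpr (by linarith)), Real.sqrt_eq_rpow, mul_assoc,
            ← Real.rpow_add (by linarith)]
          convert! hb1 h hh using 3
          ring
      _ ≤ _ := by
          rw [← Finset.mul_sum]
          gcongr
          exact hZ _
  have hs2 : ∑ h ∈ Finset.Icc 1 K, α h ≤ κ ^ (-θ) * Z := by
    refine (Finset.sum_le_sum hb2).trans ?_
    rw [← Finset.mul_sum]
    gcongr
    exact hZ _
  have hs3 : ∑ h ∈ Finset.Icc 1 K, α h * (h : ℝ) ^ (1 - θ) ≤ κ⁻¹ * Z := by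
    refine (Finset.sum_le_sum hb3).trans ?_
    rw [← Finset.mul_sum]
    gcongr
    exact hZ _
  have hs4 : ∑ h ∈ Finset.Icc 1 K, ∑ h' ∈ Finset.Icc 1 K,
      α h / h * (α h' / h') * (Nat.gcd h h' : ℝ) ^ 2 ≤ R ^ (1 - 2 * θ) * Z ^ 3 := by
    refine (sum_mul_gcd_sq_le (g := fun h => α h / h) (fun h => by positivity) K).trans ?_
    calc _ ≤ ∑ e ∈ Finset.Icc 1 K, R ^ (1 - 2 * θ) * Z ^ 2 * (e : ℝ) ^ (-(1 + θ)) := by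
          refine Finset.sum_le_sum fun e he => ?_
          have he1 := hpos e he
          have he0 : (0 : ℝ) < e := by linarith
          have hin : ∑ h ∈ (Finset.Icc 1 K).filter (fun h => e ∣ h), α h / h ≤
              R ^ (1 / 2 - θ) * ((e : ℝ) ^ (-(3 / 2 + θ)) * Z) := by
            calc _ ≤ ∑ h ∈ (Finset.Icc 1 K).filter (fun h => e ∣ h),
                  R ^ (1 / 2 - θ) * (h : ℝ) ^ (-(3 / 2 + θ)) := by
                  refine Finset.sum_le_sum fun h hh => ?_
                  have hh' := (Finset.mem_filter.mp hh).1
                  have h1 := hpos h hh'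
                  rw [div_le_iff₀ (by linarith), mul_assoc, ← Real.rpow_add_one (by linarith)]
                  convert! hb1 h hh' using 3
                  ring
              _ ≤ ∑ j ∈ Finset.Icc 1 K,
                  R ^ (1 / 2 - θ) * ((e * j : ℕ) : ℝ) ^ (-(3 / 2 + θ)) :=
                  sum_filter_dvd_le (f := fun h => R ^ (1 / 2 - θ) * (h : ℝ) ^ (-(3 / 2 + θ)))
                    (fun n => by positivity) K e (Finset.mem_Icc.mp he).1
              _ ≤ ∑ j ∈ Finset.Icc 1 K, R ^ (1 / 2 - θ) * ((e : ℝ) ^ (-(3 / 2 + θ)) *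
                  (j : ℝ) ^ (-(1 + θ))) := by
                  refine Finset.sum_le_sum fun j hj => ?_
                  have h1 := hpos j hj
                  push_cast
                  rw [Real.mul_rpow (by linarith) (by linarith)]
                  gcongr
                  norm_num
              _ ≤ _ := by
                  rw [← Finset.mul_sum, ← Finset.mul_sum]
                  gcongr
                  exact hZ _
          calc _ ≤ (e : ℝ) ^ 2 * (R ^ (1 / 2 - θ) * ((e : ℝ) ^ (-(3 / 2 + θ)) * Z)) ^ 2 := by
                gcongr
            _ = R ^ (1 - 2 * θ) * Z ^ 2 * (e : ℝ) ^ (-(1 + 2 * θ)) := by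
                have e1 : (R ^ (1 / 2 - θ)) ^ 2 = R ^ (1 - 2 * θ) := by
                  rw [← Real.rpow_natCast, ← Real.rpow_mul hR.le]
                  congr 1
                  push_cast
                  ring
                have e2 : (e : ℝ) ^ 2 * ((e : ℝ) ^ (-(3 / 2 + θ))) ^ 2
                    = (e : ℝ) ^ (-(1 + 2 * θ)) := by
                  rw [← Real.rpow_natCast, ← Real.rpow_natCast, ← Real.rpow_mul he0.le,
                    ← Real.rpow_add he0]
                  congr 1
                  push_cast
                  ring
                rw [← e1, ← e2]
                ring
            _ ≤ _ := by
                gcongr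
                linarith
      _ ≤ _ := by
          rw [← Finset.mul_sum]
          calc _ ≤ R ^ (1 - 2 * θ) * Z ^ 2 * Z := by
                gcongr
                exact hZ _
            _ = _ := by ring
  have hterm : ∀ h ∈ Finset.Icc 1 K, ∀ h' ∈ Finset.Icc 1 K,
      α h * α h' * closePairWeight N d h h' ≤
        N * (α h / h * (α h' / h') * (Nat.gcd h h' : ℝ) ^ 2) +
        8 * N * d * (α h / Real.sqrt h * (α h' / Real.sqrt h')) + α h * α h' +
        4 * d * (N : ℝ) ^ (2 * θ) * (α h * (h : ℝ) ^ (1 - θ) * α h' +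
          α h * (α h' * (h' : ℝ) ^ (1 - θ))) := by
    intro h hh h' hh'
    have h1 := hpos h hh
    have h1' := hpos h' hh'
    have hw := closePairWeight_le (N := N) hd (Finset.mem_Icc.mp hh).1 (Finset.mem_Icc.mp hh').1
    have hm : min ((N : ℝ) ^ 2) (4 * d * (h + h')) ≤
        4 * d * (N : ℝ) ^ (2 * θ) * ((h : ℝ) ^ (1 - θ) + (h' : ℝ) ^ (1 - θ)) := by
      calc _ ≤ ((N : ℝ) ^ 2) ^ θ * (4 * d * ((h : ℝ) + h')) ^ (1 - θ) :=
            le_rpow_mul_rpow_of_le (by positivity) (min_le_left _ _) (min_le_right _ _)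
              hθ.le (by linarith)
        _ = (N : ℝ) ^ (2 * θ) * ((4 * d : ℝ) ^ (1 - θ) * ((h : ℝ) + h') ^ (1 - θ)) := by
            rw [← Real.rpow_natCast, ← Real.rpow_mul (by positivity),
              Real.mul_rpow (by positivity) (by positivity)]
            norm_num
        _ ≤ (N : ℝ) ^ (2 * θ) * ((4 * d) * ((h : ℝ) ^ (1 - θ) + (h' : ℝ) ^ (1 - θ))) := by
            gcongr
            · exact Real.rpow_le_self_of_one_le (by linarith) (by linarith)
            · exact Real.rpow_add_le_add_rpow (by positivity) (by positivity)
                (by linarith) (by linarith)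
        _ = _ := by ring
    calc α h * α h' * closePairWeight N d h h' ≤ α h * α h' *
          (N * (Nat.gcd h h' : ℝ) ^ 2 / (h * h') + 8 * N * d / Real.sqrt (h * h') + 1 +
          4 * d * (N : ℝ) ^ (2 * θ) * ((h : ℝ) ^ (1 - θ) + (h' : ℝ) ^ (1 - θ))) :=
          mul_le_mul_of_nonneg_left (by linarith) (mul_nonneg (hα0 h) (hα0 h'))
      _ = _ := by
          rw [Real.sqrt_mul (by linarith)]
          ring
  calc _ ≤ _ := Finset.sum_le_sum fun h hh => Finset.sum_le_sum fun h' hh' => hterm h hh h' hh'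
    _ = N * (∑ h ∈ Finset.Icc 1 K, ∑ h' ∈ Finset.Icc 1 K,
          α h / h * (α h' / h') * (Nat.gcd h h' : ℝ) ^ 2) +
        8 * N * d * ((∑ h ∈ Finset.Icc 1 K, α h / Real.sqrt h) *
          (∑ h ∈ Finset.Icc 1 K, α h / Real.sqrt h)) +
        (∑ h ∈ Finset.Icc 1 K, α h) * (∑ h ∈ Finset.Icc 1 K, α h) +
        4 * d * (N : ℝ) ^ (2 * θ) * ((∑ h ∈ Finset.Icc 1 K, α h * (h : ℝ) ^ (1 - θ)) *
          (∑ h ∈ Finset.Icc 1 K, α h) + (∑ h ∈ Finset.Icc 1 K, α h) *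
          (∑ h ∈ Finset.Icc 1 K, α h * (h : ℝ) ^ (1 - θ))) := by
        simp_rw [Finset.sum_mul_sum, Finset.sum_add_distrib, ← Finset.mul_sum,
          Finset.sum_add_distrib, ← Finset.mul_sum]
    _ ≤ N * (R ^ (1 - 2 * θ) * Z ^ 3) +
        8 * N * d * ((R ^ (1 / 2 - θ) * Z) * (R ^ (1 / 2 - θ) * Z)) +
        (κ ^ (-θ) * Z) * (κ ^ (-θ) * Z) +
        4 * d * (N : ℝ) ^ (2 * θ) * ((κ⁻¹ * Z) * (κ ^ (-θ) * Z) +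
          (κ ^ (-θ) * Z) * (κ⁻¹ * Z)) := by
        have n1 : 0 ≤ ∑ h ∈ Finset.Icc 1 K, α h / Real.sqrt h :=
          Finset.sum_nonneg fun h _ => by positivity
        have n2 : 0 ≤ ∑ h ∈ Finset.Icc 1 K, α h := Finset.sum_nonneg fun h _ => hα0 h
        have n3 : 0 ≤ ∑ h ∈ Finset.Icc 1 K, α h * (h : ℝ) ^ (1 - θ) :=
          Finset.sum_nonneg fun h _ => by positivity
        gcongr
    _ = N * R ^ (1 - 2 * θ) * Z ^ 3 + 8 * N * d * R ^ (1 - 2 * θ) * Z ^ 2 +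
        κ ^ (-(2 * θ)) * Z ^ 2 + 8 * d * (N : ℝ) ^ (2 * θ) * κ ^ (-(1 + θ)) * Z ^ 2 := by
        have e1 : R ^ (1 - 2 * θ) = R ^ (1 / 2 - θ) * R ^ (1 / 2 - θ) := by
          rw [← Real.rpow_add hR]
          congr 1
          ring
        have e2 : κ ^ (-(2 * θ)) = κ ^ (-θ) * κ ^ (-θ) := by
          rw [← Real.rpow_add hκ]
          congr 1
          ring
        have e3 : κ ^ (-(1 + θ)) = κ⁻¹ * κ ^ (-θ) := by
          rw [← Real.rpow_neg_one, ← Real.rpow_add hκ]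
          congr 1
          ring
        rw [e1, e2, e3]
        ring
    _ ≤ _ := by
        have p1 : 0 ≤ N * R ^ (1 - 2 * θ) * Z ^ 3 * (d - 1) := by
          have : (0 : ℝ) ≤ d - 1 := by linarith
          positivity
        have p2 : 0 ≤ κ ^ (-(2 * θ)) * (Z ^ 3 + 7 * Z ^ 2) := by positivity
        have p3 : 0 ≤ d * (N : ℝ) ^ (2 * θ) * κ ^ (-(1 + θ)) * Z ^ 3 := by positivity
        linarith

lemma sum_mul_le_integral_sq {N : ℕ} {A : Finset ℕ} (hA : A ⊆ Finset.Icc (N + 1) (2 * N))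
    {F : ℝ → ℝ} (hF : Continuous F) {c : ℕ → ℝ} {τ m v : ℝ} (hτ : 0 ≤ τ) (hv : 0 < v)
    (hstep : ∀ a ∈ A, Real.sqrt a + τ ≤ Real.sqrt (a + 1 : ℕ))
    (hc : ∀ a ∈ A, ∀ t, Real.sqrt a ≤ t → t ≤ Real.sqrt a + τ → c a ≤ F t + m) :
    τ * ∑ a ∈ A, c a ≤ τ * A.card * (m + 1 / (2 * v)) +
      v / 2 * ∫ t in Real.sqrt (N + 1 : ℕ)..Real.sqrt (2 * N + 1 : ℕ), F t ^ 2 := by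
  have hintg : ∀ x y, IntervalIntegrable (fun t => F t ^ 2) MeasureTheory.volume x y := fun x y =>
    Continuous.intervalIntegrable (by fun_prop) _ _
  have hmono : ∀ a : ℕ, Real.sqrt a ≤ Real.sqrt (a + 1 : ℕ) := fun a =>
    Real.sqrt_le_sqrt (by push_cast; linarith)
  have hloc : ∀ a ∈ A, τ * c a ≤ τ * (m + 1 / (2 * v)) +
      v / 2 * ∫ t in Real.sqrt a..Real.sqrt (a + 1 : ℕ), F t ^ 2 := by
    intro a ha
    have h1 : ∫ _t in Real.sqrt a..Real.sqrt a + τ, (c a - m - 1 / (2 * v)) ≤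
        ∫ t in Real.sqrt a..Real.sqrt a + τ, v / 2 * F t ^ 2 := by
      refine intervalIntegral.integral_mono_on (by linarith) (by simp)
        ((hintg _ _).const_mul _) fun t ht => ?_
      have h2 := hc a ha t ht.1 ht.2
      have h3 : v / 2 * F t ^ 2 + 1 / (2 * v) - F t = (v * F t - 1) ^ 2 / (2 * v) := by
        field_simp
        ring
      have h4 : 0 ≤ (v * F t - 1) ^ 2 / (2 * v) := by positivity
      linarith
    rw [intervalIntegral.integral_const, intervalIntegral.integral_const_mul, smul_eq_mul,
      add_sub_cancel_left] at h1
    have h5 : ∫ t in Real.sqrt a..Real.sqrt a + τ, F t ^ 2 ≤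
        ∫ t in Real.sqrt a..Real.sqrt (a + 1 : ℕ), F t ^ 2 :=
      intervalIntegral.integral_mono_interval le_rfl (by linarith) (hstep a ha)
        (Filter.Eventually.of_forall fun t => sq_nonneg (F t)) (hintg _ _)
    have h6 := mul_le_mul_of_nonneg_left h5 (show 0 ≤ v / 2 by positivity)
    linarith
  have hext : ∑ a ∈ A, ∫ t in Real.sqrt a..Real.sqrt (a + 1 : ℕ), F t ^ 2 ≤
      ∫ t in Real.sqrt (N + 1 : ℕ)..Real.sqrt (2 * N + 1 : ℕ), F t ^ 2 := by
    rw [← intervalIntegral.sum_integral_adjacent_intervals_Ico (a := fun n : ℕ => Real.sqrt n)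
      (by omega : N + 1 ≤ 2 * N + 1) fun k _ => hintg _ _]
    refine Finset.sum_le_sum_of_subset_of_nonneg (fun a ha => ?_) fun a _ _ =>
      intervalIntegral.integral_nonneg (hmono a) fun t _ => sq_nonneg (F t)
    have := Finset.mem_Icc.mp (hA ha)
    exact Finset.mem_Ico.mpr (by omega)
  calc τ * ∑ a ∈ A, c a = ∑ a ∈ A, τ * c a := Finset.mul_sum _ _ _
    _ ≤ _ := Finset.sum_le_sum hloc
    _ = τ * A.card * (m + 1 / (2 * v)) +
        v / 2 * ∑ a ∈ A, ∫ t in Real.sqrt a..Real.sqrt (a + 1 : ℕ), F t ^ 2 := by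
      rw [Finset.sum_add_distrib, Finset.sum_const, ← Finset.mul_sum, nsmul_eq_mul]
      ring
    _ ≤ _ := by gcongr

lemma exists_sum_saw_le {N d : ℕ} (hN : 0 < N) (hd : 0 < d) {A B : Finset ℕ}
    (hA : A ⊆ Finset.Icc (N + 1) (2 * N)) (hB : B ⊆ Finset.Icc (N + 1) (2 * N))
    {κ v : ℝ} (hκ : 0 < κ) (hκd : κ * d ≤ 1 / 4) (hv : 0 < v) (D : ℝ) :
    ∃ (K : ℕ) (a : ℕ → ℝ),
      (∀ n, |a n| ≤ 4 * |D| + 6 * κ ∧ |a n| ≤ 1 / n ∧ |a n| ≤ 1 / (κ * n ^ 2)) ∧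
      ∑ x ∈ A, ∑ y ∈ B, (psiSaw (Real.sqrt (x * y) / d - D) - psiSaw (Real.sqrt (x * y) / d + D)) ≤
        A.card * (5 * κ * B.card + 1 / (2 * v)) + 8 * v * N / (κ * d) *
          ∑ h ∈ Finset.Icc 1 K, ∑ h' ∈ Finset.Icc 1 K,
            |a h| * |a h'| * closePairWeight N d h h' := by
  obtain ⟨K, a, ha, hmaj⟩ := exists_trig_majorant hκ D
  refine ⟨K, a, ha, ?_⟩
  have hNr : (1 : ℝ) ≤ N := by exact_mod_cast hN
  have hdr : (0 : ℝ) < d := by exact_mod_cast hd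
  set s : ℝ := Real.sqrt (2 * N) with hs
  have hs0 : 0 < s := Real.sqrt_pos.mpr (by linarith)
  have hss : s ^ 2 = 2 * N := Real.sq_sqrt (by linarith)
  have hs1 : 1 ≤ s := Real.one_le_sqrt.mpr (by linarith)
  have hle : ∀ x ∈ Finset.Icc (N + 1) (2 * N), Real.sqrt x ≤ s := fun x hx =>
    Real.sqrt_le_sqrt (by exact_mod_cast (Finset.mem_Icc.mp hx).2)
  have hτ : 0 < κ * d / s := by positivity
  have hτs : κ * d / s * s = κ * d := by field_simp
  have key := sum_mul_le_integral_sq hA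
    (F := fun t => ∑ y ∈ B, ∑ k ∈ Finset.Icc 1 K,
      a k * Real.cos (2 * Real.pi * k * (t * Real.sqrt y / d))) (by fun_prop)
    (c := fun x => ∑ y ∈ B, (psiSaw (Real.sqrt (x * y) / d - D) -
      psiSaw (Real.sqrt (x * y) / d + D))) (m := 5 * κ * B.card) hτ.le hv
    (fun x hx => by
      refine Real.le_sqrt_of_sq_le ?_
      have h1 : Real.sqrt x * (κ * d / s) ≤ 1 / 4 := by
        calc _ ≤ s * (κ * d / s) := by
              gcongr
              exact hle x (hA hx)
          _ ≤ _ := by linarith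
      have h2 : κ * d / s ≤ 1 / 4 := (div_le_self (by positivity) hs1).trans hκd
      have h3 : Real.sqrt x ^ 2 = x := Real.sq_sqrt (by positivity)
      push_cast
      nlinarith)
    (fun x hx t ht1 ht2 => by
      rw [mul_comm (5 * κ), ← nsmul_eq_mul, ← Finset.sum_const, ← Finset.sum_add_distrib]
      refine Finset.sum_le_sum fun y hy => ?_
      have h1 : (t - Real.sqrt x) * Real.sqrt y ≤ κ * d / s * s :=
        mul_le_mul (by linarith) (hle y (hB hy)) (by positivity) hτ.le
      have h0 : 0 ≤ (t - Real.sqrt x) * Real.sqrt y :=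
        mul_nonneg (by linarith) (Real.sqrt_nonneg _)
      have h2 := hmaj (Real.sqrt (x * y) / d) ((t - Real.sqrt x) * Real.sqrt y / d)
        (by positivity) (by rw [div_le_iff₀ hdr]; linarith)
      rwa [show Real.sqrt (x * y) / d + (t - Real.sqrt x) * Real.sqrt y / d =
        t * Real.sqrt y / d by rw [Real.sqrt_mul (by positivity)]; ring] at h2)
  have hI := integral_sq_trig_sum_le hN hd B hB K a
  set S := ∑ h ∈ Finset.Icc 1 K, ∑ h' ∈ Finset.Icc 1 K,
    |a h| * |a h'| * closePairWeight N d h h' with hS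
  have hsq : Real.sqrt N * s = Real.sqrt 2 * N := by
    rw [hs, Real.sqrt_mul (by norm_num), mul_left_comm, Real.mul_self_sqrt (by linarith)]
  have hI0 : 0 ≤ 8 * Real.sqrt N * S := le_trans
    (intervalIntegral.integral_nonneg (Real.sqrt_le_sqrt (by push_cast; linarith))
      fun t _ => sq_nonneg _) hI
  have hS0 : 0 ≤ S := by
    by_contra! h
    have : 0 < Real.sqrt N := Real.sqrt_pos.mpr (by linarith)
    nlinarith
  have h2 : Real.sqrt 2 ≤ 2 := Real.sqrt_le_iff.mpr (by norm_num)
  refine le_of_mul_le_mul_left ?_ hτ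
  refine key.trans ?_
  calc _ ≤ κ * d / s * A.card * (5 * κ * B.card + 1 / (2 * v)) +
        v / 2 * (8 * Real.sqrt N * S) := by gcongr
    _ = κ * d / s * (A.card * (5 * κ * B.card + 1 / (2 * v)) +
        4 * v * (Real.sqrt N * s) / (κ * d) * S) := by
      field_simp
      ring
    _ ≤ _ := by
      rw [hsq]
      gcongr κ * d / s * (_ + ?_ / (κ * d) * S)
      nlinarith [mul_pos hv (show (0 : ℝ) < N by linarith)]

lemma exists_abs_remTerm_le {θ : ℝ} (hθ : 0 < θ) (hθ1 : θ ≤ 1 / 4) :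
    ∃ C : ℝ, 0 < C ∧ ∀ (N d : ℕ) (A B : Finset ℕ) (Δ κ v : ℝ), 0 < N → 0 < d →
      A ⊆ Finset.Icc (N + 1) (2 * N) → B ⊆ Finset.Icc (N + 1) (2 * N) →
      0 < κ → κ * d ≤ 1 / 4 → κ * d ≤ Δ → 0 < v →
      |remTerm A B Δ d| ≤ A.card * (5 * κ * B.card + 1 / (2 * v)) + C * v * N / (κ * d) *
        (N * d * (10 * Δ / d) ^ (1 - 2 * θ) + κ ^ (-(2 * θ)) +
          d * (N : ℝ) ^ (2 * θ) * κ ^ (-(1 + θ))) := by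
  obtain ⟨C, hC, hS⟩ := exists_sum_closePairWeight_le hθ hθ1
  refine ⟨8 * C, by positivity, fun N d A B Δ κ v hN hd hA hB hκ hκ1 hκΔ hv => ?_⟩
  have hdr : (0 : ℝ) < d := by exact_mod_cast hd
  have hΔ : 0 < Δ := lt_of_lt_of_le (by positivity) hκΔ
  have hκ2 : κ ≤ Δ / d := (le_div_iff₀ hdr).mpr hκΔ
  have key : ∀ D : ℝ, |D| = Δ / d → ∑ x ∈ A, ∑ y ∈ B,
      (psiSaw (Real.sqrt (x * y) / d - D) - psiSaw (Real.sqrt (x * y) / d + D)) ≤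
      A.card * (5 * κ * B.card + 1 / (2 * v)) + 8 * C * v * N / (κ * d) *
        (N * d * (10 * Δ / d) ^ (1 - 2 * θ) + κ ^ (-(2 * θ)) +
          d * (N : ℝ) ^ (2 * θ) * κ ^ (-(1 + θ))) := by
    intro D hD
    obtain ⟨K, a, ha, hle⟩ := exists_sum_saw_le hN hd hA hB hκ hκ1 hv D
    refine hle.trans ?_
    have h1 := hS N d K a κ (10 * Δ / d) hd hκ (by positivity) fun n =>
      ⟨(ha n).1.trans (by rw [hD, mul_div_assoc]; linarith), (ha n).2⟩
    have h2 := mul_le_mul_of_nonneg_left h1 (show 0 ≤ 8 * v * N / (κ * d) by positivity)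
    refine add_le_add le_rfl (h2.trans (le_of_eq ?_))
    ring
  rw [abs_le']
  constructor
  · refine le_trans (le_of_eq ?_) (key (Δ / d) (abs_of_nonneg (by positivity)))
    simp_rw [remTerm, sub_div, add_div]
  · refine le_trans (le_of_eq ?_) (key (-(Δ / d)) (by rw [abs_neg, abs_of_nonneg (by positivity)]))
    simp_rw [remTerm, sub_div, add_div, ← Finset.sum_neg_distrib]
    refine Finset.sum_congr rfl fun x _ => Finset.sum_congr rfl fun y _ => ?_
    rw [sub_neg_eq_add, ← sub_eq_add_neg, neg_sub]

lemma exists_abs_remTerm_rpow_le {ε δ c : ℝ} (hε : 0 < ε) (hε1 : ε ≤ 1) (hδ : 0 < δ)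
    (hδ1 : δ < 1 / 2) (hc : 0 < c) :
    ∃ C : ℝ, 0 < C ∧ ∀ (N d : ℕ) (A B : Finset ℕ) (v : ℝ), 0 < N → 0 < d →
      A ⊆ Finset.Icc (N + 1) (2 * N) → B ⊆ Finset.Icc (N + 1) (2 * N) → 0 < v →
      (d : ℝ) ≤ c * (N : ℝ) ^ (1 / 2 - δ - 4 * ε / 3) →
      |remTerm A B ((N : ℝ) ^ (-δ)) d| ≤
        5 / 4 * A.card * B.card * (N : ℝ) ^ (-(δ + ε)) / d + A.card / (2 * v) +
          C * v * (N : ℝ) ^ (2 + 9 * ε / 8) := by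
  obtain ⟨C, hC, hrem⟩ := exists_abs_remTerm_le (θ := ε / 8) (by linarith) (by linarith)
  set L : ℝ := 4 * c + 1 with hL
  have hL1 : 1 ≤ L := by linarith
  refine ⟨4 * C * (10 * L + L + L ^ 2 * L), by positivity, fun N d A B v hN hd hA hB hv hdN => ?_⟩
  have hNr : (1 : ℝ) ≤ N := by exact_mod_cast hN
  have hN0 : (0 : ℝ) < N := by linarith
  have hdr : (1 : ℝ) ≤ d := by exact_mod_cast hd
  have hd0 : (0 : ℝ) < d := by linarith
  set θ : ℝ := ε / 8 with hθ
  set n : ℝ := (N : ℝ) with hn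
  set κ : ℝ := n ^ (-(δ + ε)) / (4 * d) with hκ
  have hκ0 : 0 < κ := by positivity
  have hκd : κ * d = n ^ (-(δ + ε)) / 4 := by
    rw [hκ]
    field_simp
  have hκinv : κ⁻¹ = 4 * d * n ^ (δ + ε) := by
    rw [hκ, Real.rpow_neg hN0.le]
    field_simp
  have hLpow : ∀ s : ℝ, s ≤ 1 → L ^ s ≤ L := fun s hs => by
    simpa using Real.rpow_le_rpow_of_exponent_le hL1 hs
  have hκL : κ⁻¹ ≤ L * n ^ (1 / 2 : ℝ) := by
    calc κ⁻¹ ≤ 4 * (c * n ^ (1 / 2 - δ - 4 * ε / 3)) * n ^ (δ + ε) := by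
          rw [hκinv]
          gcongr
      _ = 4 * c * n ^ (1 / 2 - ε / 3) := by
          rw [mul_assoc, mul_assoc, mul_assoc, ← Real.rpow_add hN0]
          ring_nf
      _ ≤ _ := by
          gcongr
          · linarith
          · linarith
  have hκs : ∀ s : ℝ, 0 ≤ s → s ≤ 1 → κ ^ (-s) ≤ L * n ^ (s / 2) := by
    intro s hs0 hs1
    calc κ ^ (-s) = κ⁻¹ ^ s := by rw [Real.rpow_neg hκ0.le, Real.inv_rpow hκ0.le]
      _ ≤ (L * n ^ (1 / 2 : ℝ)) ^ s := by gcongr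
      _ = L ^ s * n ^ (s / 2) := by
          rw [Real.mul_rpow (by linarith) (by positivity), ← Real.rpow_mul hN0.le]
          ring_nf
      _ ≤ _ := by
          gcongr
          exact hLpow s hs1
  have hΔL : d * n ^ δ ≤ L * n ^ (1 / 2 : ℝ) := by
    refine le_trans ?_ hκL
    rw [hκinv]
    have : n ^ δ ≤ n ^ (δ + ε) := Real.rpow_le_rpow_of_exponent_le hNr (by linarith)
    gcongr
    linarith
  have t1 : n * d * (10 * n ^ (-δ) / d) ^ (1 - 2 * θ) ≤ 10 * L * n ^ (1 - δ + θ) := by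
    have h1 : (d * n ^ δ) ^ (2 * θ) ≤ L * n ^ θ := by
      calc _ ≤ (L * n ^ (1 / 2 : ℝ)) ^ (2 * θ) := by gcongr
        _ = L ^ (2 * θ) * n ^ θ := by
            rw [Real.mul_rpow (by linarith) (by positivity), ← Real.rpow_mul hN0.le]
            ring_nf
        _ ≤ _ := by
            gcongr
            exact hLpow _ (by linarith)
    have h2 : (10 : ℝ) ^ (1 - 2 * θ) ≤ 10 := by
      simpa using Real.rpow_le_rpow_of_exponent_le (show (1 : ℝ) ≤ 10 by norm_num)
        (show 1 - 2 * θ ≤ 1 by linarith)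
    have h3 : n * d * (10 * n ^ (-δ) / d) ^ (1 - 2 * θ) =
        (10 : ℝ) ^ (1 - 2 * θ) * (n * n ^ (-δ)) * (d * n ^ δ) ^ (2 * θ) := by
      have h4 : 10 * n ^ (-δ) / d = 10 * (d * n ^ δ)⁻¹ := by
        rw [Real.rpow_neg hN0.le]
        field_simp
      have h5 : ((d : ℝ) * n ^ δ)⁻¹ ^ (1 - 2 * θ) = (d * n ^ δ)⁻¹ * (d * n ^ δ) ^ (2 * θ) := by
        rw [Real.inv_rpow (by positivity), ← Real.rpow_neg (by positivity), ← Real.rpow_neg_one,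
          ← Real.rpow_add (by positivity)]
        ring_nf
      rw [h4, Real.mul_rpow (by norm_num) (by positivity), h5, Real.rpow_neg hN0.le]
      field_simp
    rw [h3]
    calc _ ≤ 10 * (n * n ^ (-δ)) * (L * n ^ θ) := by gcongr
      _ = 10 * L * (n ^ (1 : ℝ) * n ^ (-δ) * n ^ θ) := by
          rw [Real.rpow_one]
          ring
      _ = _ := by
          rw [← Real.rpow_add hN0, ← Real.rpow_add hN0]
          ring_nf
  have t2 : κ ^ (-(2 * θ)) ≤ L * n ^ (1 - δ + θ) := by
    refine (hκs (2 * θ) (by linarith) (by linarith)).trans ?_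
    gcongr
    linarith
  have t3 : d * n ^ (2 * θ) * κ ^ (-(1 + θ)) ≤ L ^ 2 * L * n ^ (1 - δ + θ) := by
    have h1 : d * κ⁻¹ ≤ L ^ 2 * n ^ (1 - δ - 5 * ε / 3) := by
      calc d * κ⁻¹ = 4 * d ^ 2 * n ^ (δ + ε) := by
            rw [hκinv]
            ring
        _ ≤ 4 * (c * n ^ (1 / 2 - δ - 4 * ε / 3)) ^ 2 * n ^ (δ + ε) := by gcongr
        _ = 4 * c ^ 2 * n ^ (1 - δ - 5 * ε / 3) := by
            rw [mul_pow, ← Real.rpow_natCast, ← Real.rpow_natCast, ← Real.rpow_mul hN0.le,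
              mul_assoc, mul_assoc, mul_assoc, ← Real.rpow_add hN0]
            push_cast
            ring_nf
        _ ≤ _ := by
            gcongr
            nlinarith
    calc d * n ^ (2 * θ) * κ ^ (-(1 + θ)) = n ^ (2 * θ) * (d * κ⁻¹) * κ ^ (-θ) := by
          rw [neg_add, Real.rpow_add hκ0, Real.rpow_neg_one]
          ring
      _ ≤ n ^ (2 * θ) * (L ^ 2 * n ^ (1 - δ - 5 * ε / 3)) * (L * n ^ (θ / 2)) := by
          gcongr
          exact hκs θ (by linarith) (by linarith)
      _ = L ^ 2 * L * (n ^ (2 * θ) * n ^ (1 - δ - 5 * ε / 3) * n ^ (θ / 2)) := by ring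
      _ ≤ _ := by
          rw [← Real.rpow_add hN0, ← Real.rpow_add hN0]
          exact mul_le_mul_of_nonneg_left
            (Real.rpow_le_rpow_of_exponent_le hNr (by linarith)) (by positivity)
  have hneg : n ^ (-(δ + ε)) ≤ 1 := Real.rpow_le_one_of_one_le_of_nonpos hNr (by linarith)
  have hneg2 : n ^ (-(δ + ε)) ≤ n ^ (-δ) := Real.rpow_le_rpow_of_exponent_le hNr (by linarith)
  have hmain := hrem N d A B (n ^ (-δ)) κ v hN hd hA hB hκ0 (by rw [hκd]; linarith)
    (by rw [hκd]; linarith [Real.rpow_pos_of_pos hN0 (-(δ + ε))]) hv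
  refine hmain.trans ?_
  calc _ ≤ A.card * (5 * κ * B.card + 1 / (2 * v)) + C * v * n / (κ * d) *
        (10 * L * n ^ (1 - δ + θ) + L * n ^ (1 - δ + θ) + L ^ 2 * L * n ^ (1 - δ + θ)) := by
        gcongr
    _ = A.card * (5 * κ * B.card + 1 / (2 * v)) + 4 * C * (10 * L + L + L ^ 2 * L) * v *
        (n ^ (1 : ℝ) * n ^ (δ + ε) * n ^ (1 - δ + θ)) := by
        rw [hκd, Real.rpow_neg hN0.le, Real.rpow_one]
        field_simp
    _ = _ := by
        rw [← Real.rpow_add hN0, ← Real.rpow_add hN0,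
          show 1 + (δ + ε) + (1 - δ + θ) = 2 + 9 * ε / 8 by rw [hθ]; ring, hκ]
        congr 1
        field_simp

lemma exists_three_pow_card_primeFactors_le {ε : ℝ} (hε : 0 < ε) :
    ∃ C : ℝ, 0 < C ∧ ∀ d : ℕ, 0 < d → (3 : ℝ) ^ d.primeFactors.card ≤ C * (d : ℝ) ^ ε := by
  set M : ℕ := ⌈(3 : ℝ) ^ ε⁻¹⌉₊ with hM
  have hbig : ∀ p : ℕ, M ≤ p → (3 : ℝ) ≤ (p : ℝ) ^ ε := by
    intro p hp
    have h1 : (3 : ℝ) ^ ε⁻¹ ≤ p := (Nat.le_ceil _).trans (by exact_mod_cast hp)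
    calc (3 : ℝ) = ((3 : ℝ) ^ ε⁻¹) ^ ε := by
          rw [← Real.rpow_mul (by norm_num), inv_mul_cancel₀ hε.ne', Real.rpow_one]
      _ ≤ _ := by gcongr
  refine ⟨3 ^ M, by positivity, fun d hd => ?_⟩
  have hone : ∀ p ∈ d.primeFactors, (1 : ℝ) ≤ p := fun p hp => by
    exact_mod_cast (Nat.prime_of_mem_primeFactors hp).one_le
  have hcard : (d.primeFactors.filter (· < M)).card ≤ M := by
    refine (Finset.card_le_card (t := Finset.range M) fun p hp => ?_).trans (by simp)
    exact Finset.mem_range.mpr (Finset.mem_filter.mp hp).2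
  rw [← Finset.card_filter_add_card_filter_not (s := d.primeFactors) (· < M), pow_add]
  refine mul_le_mul (pow_le_pow_right₀ (by norm_num) hcard) ?_ (by positivity) (by positivity)
  calc (3 : ℝ) ^ (d.primeFactors.filter (¬ · < M)).card
      = ∏ p ∈ d.primeFactors.filter (¬ · < M), (3 : ℝ) := by simp
    _ ≤ ∏ p ∈ d.primeFactors.filter (¬ · < M), (p : ℝ) ^ ε :=
        Finset.prod_le_prod (fun _ _ => by norm_num) fun p hp =>
          hbig p (not_lt.mp (Finset.mem_filter.mp hp).2)
    _ ≤ ∏ p ∈ d.primeFactors, (p : ℝ) ^ ε :=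
        Finset.prod_le_prod_of_subset_of_one_le (Finset.filter_subset _ _)
          (fun p _ => by positivity) fun p hp _ => Real.one_le_rpow (hone p hp) hε.le
    _ = (∏ p ∈ d.primeFactors, (p : ℝ)) ^ ε :=
        Real.finsetProd_rpow _ _ (fun p _ => by positivity) _
    _ ≤ _ := by
        gcongr
        rw [← Nat.cast_prod]
        exact_mod_cast Nat.le_of_dvd hd (Nat.prod_primeFactors_dvd d)

lemma remTerm_comm (A B : Finset ℕ) (Δ : ℝ) (d : ℕ) : remTerm A B Δ d = remTerm B A Δ d := by
  rw [remTerm, remTerm, Finset.sum_comm]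
  simp_rw [mul_comm]

lemma rpow_le_rpow_add_rpow {a b u : ℝ} (ha : 0 < a) (hau : a ≤ u) (hub : u ≤ b) (s : ℝ) :
    u ^ s ≤ a ^ s + b ^ s := by
  have hu : 0 < u := ha.trans_le hau
  have h1 : 0 < a ^ s := Real.rpow_pos_of_pos ha s
  have h2 : 0 < b ^ s := Real.rpow_pos_of_pos (hu.trans_le hub) s
  rcases le_total 0 s with hs | hs
  · linarith [Real.rpow_le_rpow hu.le hub hs]
  · linarith [Real.rpow_le_rpow_of_nonpos ha hau hs]

lemma exists_sum_abs_remTerm_le_of_le {η β δ ε c₁ c₂ : ℝ} (hη : η ≤ β) (hβ1 : β ≤ 1)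
    (hδ : 0 < δ) (hδ1 : δ < 1 / 2) (hε : 0 < ε) (hηβ : 4 * (1 + δ) / 3 + ε ≤ η + β)
    (hc₁ : 0 < c₁) (hc : c₁ ≤ c₂) :
    ∃ C : ℝ, 0 < C ∧ ∀ (N : ℕ) (A B : Finset ℕ) (X : ℝ), 0 < N →
      A ⊆ Finset.Icc (N + 1) (2 * N) → B ⊆ Finset.Icc (N + 1) (2 * N) →
      c₁ * (N : ℝ) ^ η ≤ A.card → (A.card : ℝ) ≤ c₂ * (N : ℝ) ^ η →
      c₁ * (N : ℝ) ^ β ≤ B.card → (B.card : ℝ) ≤ c₂ * (N : ℝ) ^ β →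
      X = 2 * (N : ℝ) ^ (-δ) * A.card * B.card →
      ∑ d ∈ Finset.Ico 1 ⌈X ^ (((η + β) / 2 - 2 / 3 - 2 * δ / 3) / (η + β - δ) - ε)⌉₊,
        (if Squarefree d then (1 : ℝ) else 0) * 3 ^ d.primeFactors.card *
          |remTerm A B ((N : ℝ) ^ (-δ)) d| ≤ C * X * (N : ℝ) ^ (-(ε / 2)) := by
  set p : ℝ := η + β - δ with hp
  set α : ℝ := ((η + β) / 2 - 2 / 3 - 2 * δ / 3) / p - ε with hα
  have hp1 : 4 / 3 ≤ p := by linarith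
  have hεp : ε * (4 / 3) ≤ ε * p := mul_le_mul_of_nonneg_left hp1 hε.le
  have hq : p * α = (η + β) / 2 - 2 / 3 - 2 * δ / 3 - ε * p := by
    have : p ≠ 0 := by linarith
    rw [hα]
    field_simp
  have hc₂ : 0 < c₂ := hc₁.trans_le hc
  set E : ℝ := (2 * c₁ ^ 2) ^ α + (2 * c₂ ^ 2) ^ α with hE
  have hE0 : 0 < E := by positivity
  obtain ⟨C₁, hC₁, hrem⟩ := exists_abs_remTerm_rpow_le hε (by linarith) hδ hδ1 hE0
  obtain ⟨C₂, hC₂, hthree⟩ := exists_three_pow_card_primeFactors_le (ε := ε / 8) (by linarith)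
  obtain ⟨Z, hZ0, hZ⟩ := exists_sum_rpow_neg_le (s := 1 + ε / 8) (by linarith)
  refine ⟨C₂ * (5 / 8) * E ^ (ε / 4) * Z +
    E * (C₂ * E ^ (ε / 8) * (c₂ / 2 + C₁)) / (2 * c₁ ^ 2), by positivity,
    fun N A B X hN hA hB hA1 hA2 hB1 hB2 hX => ?_⟩
  have hNr : (1 : ℝ) ≤ N := by exact_mod_cast hN
  have hN0 : (0 : ℝ) < N := by linarith
  set n : ℝ := (N : ℝ) with hn
  have hnp : n ^ p = n ^ (-δ) * n ^ η * n ^ β := by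
    rw [← Real.rpow_add hN0, ← Real.rpow_add hN0]
    congr 1
    rw [hp]
    ring
  have hX1 : 2 * c₁ ^ 2 * n ^ p ≤ X := by
    calc _ = 2 * n ^ (-δ) * (c₁ * n ^ η) * (c₁ * n ^ β) := by
          rw [hnp]
          ring
      _ ≤ _ := by
          rw [hX]
          gcongr
  have hX2 : X ≤ 2 * c₂ ^ 2 * n ^ p := by
    calc X ≤ 2 * n ^ (-δ) * (c₂ * n ^ η) * (c₂ * n ^ β) := by
          rw [hX]
          gcongr
      _ = _ := by
          rw [hnp]
          ring
  have hX0 : 0 < X := lt_of_lt_of_le (by positivity) hX1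
  have hD : X ^ α ≤ E * n ^ (p * α) := by
    have hnp0 : 0 < n ^ p := by positivity
    calc X ^ α = (X / n ^ p) ^ α * n ^ (p * α) := by
          rw [Real.rpow_mul hN0.le, ← Real.mul_rpow (by positivity) hnp0.le,
            div_mul_cancel₀ _ hnp0.ne']
      _ ≤ _ := by
          gcongr
          exact rpow_le_rpow_add_rpow (by positivity) ((le_div_iff₀ hnp0).mpr hX1)
            ((div_le_iff₀ hnp0).mpr hX2) α
  set w : ℝ := η / 2 + 1 + 9 * ε / 16 with hw
  set v : ℝ := n ^ (η / 2 - 1 - 9 * ε / 16) with hv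
  have hv0 : 0 < v := by positivity
  have hterm : ∀ d ∈ Finset.Ico 1 ⌈X ^ α⌉₊,
      (if Squarefree d then (1 : ℝ) else 0) * 3 ^ d.primeFactors.card *
        |remTerm A B (n ^ (-δ)) d| ≤
      C₂ * (5 / 8) * E ^ (ε / 4) * X * n ^ (-(3 * ε / 4)) * (d : ℝ) ^ (-(1 + ε / 8)) +
        C₂ * E ^ (ε / 8) * (c₂ / 2 + C₁) * n ^ (ε / 8 + w) := by
    intro d hd
    have hd1 : 0 < d := (Finset.mem_Ico.mp hd).1
    have hdr : (0 : ℝ) < d := by exact_mod_cast hd1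
    have hdD : (d : ℝ) ≤ E * n ^ (p * α) := (Nat.lt_ceil.mp (Finset.mem_Ico.mp hd).2).le.trans hD
    have hdN : (d : ℝ) ≤ E * n ^ (1 / 2 - δ - 4 * ε / 3) := by
      refine hdD.trans (mul_le_mul_of_nonneg_left
        (Real.rpow_le_rpow_of_exponent_le hNr ?_) hE0.le)
      rw [hq]
      linarith
    have hdpow : ∀ s : ℝ, 0 ≤ s → (d : ℝ) ^ s ≤ E ^ s * n ^ s := by
      intro s hs
      rw [← Real.mul_rpow hE0.le hN0.le]
      refine Real.rpow_le_rpow hdr.le (hdN.trans (mul_le_mul_of_nonneg_left ?_ hE0.le)) hs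
      simpa using Real.rpow_le_rpow_of_exponent_le hNr
        (show 1 / 2 - δ - 4 * ε / 3 ≤ 1 by linarith)
    have hr : |remTerm A B (n ^ (-δ)) d| ≤
        5 / 8 * X * n ^ (-ε) / d + (c₂ / 2 + C₁) * n ^ w := by
      refine (hrem N d A B v hN hd1 hA hB hv0 hdN).trans ?_
      have h1 : 5 / 4 * A.card * B.card * n ^ (-(δ + ε)) / d = 5 / 8 * X * n ^ (-ε) / d := by
        rw [hX, neg_add, Real.rpow_add hN0]
        ring
      have h2 : A.card / (2 * v) ≤ c₂ / 2 * n ^ w := by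
        have h3 : n ^ w * v = n ^ η := by
          rw [hv, ← Real.rpow_add hN0]
          congr 1
          rw [hw]
          ring
        rw [div_le_iff₀ (by positivity)]
        calc _ ≤ c₂ * n ^ η := hA2
          _ = _ := by
            rw [← h3]
            ring
      have h4 : C₁ * v * n ^ (2 + 9 * ε / 8) = C₁ * n ^ w := by
        rw [mul_assoc, hv, ← Real.rpow_add hN0]
        congr 2
        rw [hw]
        ring
      rw [← hn, h1, h4]
      linarith
    have hif : (if Squarefree d then (1 : ℝ) else 0) ≤ 1 := by split_ifs <;> norm_num
    have e1 : (d : ℝ) ^ (ε / 8) / d = d ^ (ε / 4) * (d : ℝ) ^ (-(1 + ε / 8)) := by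
      rw [← Real.rpow_add hdr, ← Real.rpow_sub_one hdr.ne']
      congr 1
      ring
    have e2 : n ^ (-(3 * ε / 4)) = n ^ (ε / 4) * n ^ (-ε) := by
      rw [← Real.rpow_add hN0]
      congr 1
      ring
    calc _ ≤ 1 * (C₂ * (d : ℝ) ^ (ε / 8)) *
          (5 / 8 * X * n ^ (-ε) / d + (c₂ / 2 + C₁) * n ^ w) := by
          gcongr
          exact hthree d hd1
      _ = C₂ * (5 / 8) * X * n ^ (-ε) * (d : ℝ) ^ (-(1 + ε / 8)) * d ^ (ε / 4) +
          C₂ * (c₂ / 2 + C₁) * n ^ w * d ^ (ε / 8) := by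
          linear_combination C₂ * (5 / 8) * X * n ^ (-ε) * e1
      _ ≤ C₂ * (5 / 8) * X * n ^ (-ε) * (d : ℝ) ^ (-(1 + ε / 8)) *
            (E ^ (ε / 4) * n ^ (ε / 4)) +
          C₂ * (c₂ / 2 + C₁) * n ^ w * (E ^ (ε / 8) * n ^ (ε / 8)) := by
          gcongr
          · exact hdpow _ (by linarith)
          · exact hdpow _ (by linarith)
      _ = _ := by
          rw [e2, Real.rpow_add hN0 (ε / 8) w]
          ring
  have hcard : ((Finset.Ico 1 ⌈X ^ α⌉₊).card : ℝ) ≤ E * n ^ (p * α) := by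
    have h1 : 1 ≤ ⌈X ^ α⌉₊ := Nat.ceil_pos.mpr (by positivity)
    rw [Nat.card_Ico, Nat.cast_sub h1, Nat.cast_one]
    linarith [Nat.ceil_lt_add_one (show 0 ≤ X ^ α by positivity)]
  have hfirst : n ^ (-(3 * ε / 4)) ≤ n ^ (-(ε / 2)) :=
    Real.rpow_le_rpow_of_exponent_le hNr (by linarith)
  have hsecond : n ^ (p * α) * n ^ (ε / 8 + w) ≤ X / (2 * c₁ ^ 2) * n ^ (-(ε / 2)) := by
    calc _ ≤ n ^ p * n ^ (-(ε / 2)) := by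
          rw [← Real.rpow_add hN0, ← Real.rpow_add hN0]
          refine Real.rpow_le_rpow_of_exponent_le hNr ?_
          rw [hq, hw]
          linarith
      _ ≤ _ := by
          gcongr
          rw [le_div_iff₀ (by positivity)]
          linarith
  refine (Finset.sum_le_sum hterm).trans ?_
  rw [Finset.sum_add_distrib, ← Finset.mul_sum, Finset.sum_const, nsmul_eq_mul]
  calc _ ≤ C₂ * (5 / 8) * E ^ (ε / 4) * X * n ^ (-(ε / 2)) * Z +
        E * n ^ (p * α) * (C₂ * E ^ (ε / 8) * (c₂ / 2 + C₁) * n ^ (ε / 8 + w)) := by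
        gcongr
        exact hZ _
    _ = C₂ * (5 / 8) * E ^ (ε / 4) * X * n ^ (-(ε / 2)) * Z +
        E * (C₂ * E ^ (ε / 8) * (c₂ / 2 + C₁)) * (n ^ (p * α) * n ^ (ε / 8 + w)) := by ring
    _ ≤ C₂ * (5 / 8) * E ^ (ε / 4) * X * n ^ (-(ε / 2)) * Z +
        E * (C₂ * E ^ (ε / 8) * (c₂ / 2 + C₁)) * (X / (2 * c₁ ^ 2) * n ^ (-(ε / 2))) := by
        gcongr
    _ = _ := by ring

/-- **Estimate (4.2).** `Σ_{d < X^α} μ²(d) 3^{ν(d)} |r(𝒜,d)| ≪ X N^{−ε/2}`. -/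
theorem remainder_sum_bound :
    ∀ η β δ : ℝ, 0 < η → η ≤ 1 → 0 < β → β ≤ 1 → 0 < δ → δ < 1 / 2 →
      ∃ ε₀ : ℝ, 0 < ε₀ ∧ ∀ ε : ℝ, 0 < ε → ε ≤ ε₀ →
        4 * (1 + δ) / 3 + ε ≤ η + β →
        ∀ c₁ c₂ : ℝ, 0 < c₁ → c₁ ≤ c₂ →
          ∃ C : ℝ, 0 < C ∧ ∃ N₀ : ℕ, ∀ N : ℕ, N₀ ≤ N →
            ∀ A B : Finset ℕ, A ⊆ Finset.Icc (N + 1) (2 * N) → B ⊆ Finset.Icc (N + 1) (2 * N) →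
              c₁ * (N : ℝ) ^ η ≤ A.card → (A.card : ℝ) ≤ c₂ * (N : ℝ) ^ η →
              c₁ * (N : ℝ) ^ β ≤ B.card → (B.card : ℝ) ≤ c₂ * (N : ℝ) ^ β →
                ∑ d ∈ Finset.Ico 1
                    ⌈(2 * (N : ℝ) ^ (-δ) * A.card * B.card) ^
                      (((η + β) / 2 - 2 / 3 - 2 * δ / 3) / (η + β - δ) - ε)⌉₊,
                    (if Squarefree d then (1 : ℝ) else 0) * 3 ^ d.primeFactors.card *
                      |remTerm A B ((N : ℝ) ^ (-δ)) d| ≤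
                  C * (2 * (N : ℝ) ^ (-δ) * A.card * B.card) * (N : ℝ) ^ (-(ε / 2)) := by
  intro η β δ _ hη1 _ hβ1 hδ hδ1
  refine ⟨1, one_pos, fun ε hε _ hηβ c₁ c₂ hc₁ hc => ?_⟩
  rcases le_total η β with h | h
  · obtain ⟨C, hC, hmain⟩ := exists_sum_abs_remTerm_le_of_le h hβ1 hδ hδ1 hε hηβ hc₁ hc
    exact ⟨C, hC, 1, fun N hN A B hA hB hA1 hA2 hB1 hB2 =>
      hmain N A B _ hN hA hB hA1 hA2 hB1 hB2 rfl⟩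
  · obtain ⟨C, hC, hmain⟩ := exists_sum_abs_remTerm_le_of_le h hη1 hδ hδ1 hε
      (by linarith) hc₁ hc
    refine ⟨C, hC, 1, fun N hN A B hA hB hA1 hA2 hB1 hB2 => ?_⟩
    have := hmain N B A (2 * (N : ℝ) ^ (-δ) * A.card * B.card) hN hB hA hB1 hB2 hA1 hA2
      (by ring)
    simpa only [add_comm β η, remTerm_comm B A] using this
end

section
/- Let 0 < δ < 1/2 and ε > 0. Then for all sufficiently large N, all 𝔄, 𝔅 ⊆ {N+1, …, 2N}, and Δ = N^{−δ}, one has Σ_p Σ_{a∈𝔄} Σ_{b∈𝔅} #{l ∈ ℤ : |√(ab) − l| < Δ and p² | l} ≤ N^{2 − δ − 1/15 + ε}, where the outer sum runs over primes p with N^{1/15} < p ≤ 2√(2N). -/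
open scoped Classical

open Finset in
/-- The divisor bound: `d(n) ≪ n ^ η` for every `η > 0`. -/
theorem exists_card_divisors_le_mul_rpow {η : ℝ} (hη : 0 < η) :
    ∃ C : ℝ, 1 ≤ C ∧ ∀ n : ℕ, n ≠ 0 → (#n.divisors : ℝ) ≤ C * (n : ℝ) ^ η := by
  obtain ⟨P, hP⟩ := exists_nat_gt ((2 : ℝ) ^ (1 / η))
  obtain ⟨c, hc1, hc⟩ : ∃ c : ℝ, 1 ≤ c ∧ 1 ≤ c * (η * Real.log 2) := by
    have : 0 < η * Real.log 2 := by positivity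
    refine ⟨max 1 (1 / (η * Real.log 2)), le_max_left _ _, ?_⟩
    calc (1 : ℝ) = 1 / (η * Real.log 2) * (η * Real.log 2) := by field_simp
      _ ≤ _ := by gcongr; exact le_max_right _ _
  have hsmall (p k : ℕ) (hp : 2 ≤ p) : (k + 1 : ℝ) ≤ c * ((p : ℝ) ^ k) ^ η := by
    have h2p : ((2 : ℝ) ^ k) ^ η ≤ ((p : ℝ) ^ k) ^ η := by gcongr; exact_mod_cast hp
    have h2 : 1 + k * (η * Real.log 2) ≤ ((2 : ℝ) ^ k) ^ η := by
      rw [Real.rpow_def_of_pos (by positivity), Real.log_pow]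
      linarith [Real.add_one_le_exp (k * Real.log 2 * η)]
    have hk : (k : ℝ) * 1 ≤ k * (c * (η * Real.log 2)) := by gcongr
    calc (k + 1 : ℝ) ≤ c * (1 + k * (η * Real.log 2)) := by linarith
      _ ≤ _ := by gcongr; exact h2.trans h2p
  have hlarge (p k : ℕ) (hp : P ≤ p) : (k + 1 : ℝ) ≤ ((p : ℝ) ^ k) ^ η := by
    have h2 : (2 : ℝ) ≤ (p : ℝ) ^ η := by
      calc (2 : ℝ) = ((2 : ℝ) ^ (1 / η)) ^ η := by
            rw [← Real.rpow_mul (by norm_num), one_div_mul_cancel hη.ne', Real.rpow_one]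
        _ ≤ _ := by
            gcongr
            exact hP.le.trans (by exact_mod_cast hp)
    calc (k + 1 : ℝ) ≤ 2 ^ k := by exact_mod_cast Nat.lt_two_pow_self
      _ ≤ ((p : ℝ) ^ η) ^ k := by gcongr
      _ = _ := by
        rw [← Real.rpow_mul_natCast (by positivity), ← Real.rpow_natCast_mul (by positivity),
          mul_comm]
  refine ⟨c ^ P, one_le_pow₀ hc1, fun n hn => ?_⟩
  have hn' : (n : ℝ) ^ η = ∏ p ∈ n.primeFactors, ((p : ℝ) ^ n.factorization p) ^ η := by
    rw [Real.finsetProd_rpow _ _ (fun _ _ => by positivity)]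
    congr 1
    exact_mod_cast (Nat.prod_factorization_pow_eq_self hn).symm
  have hcP : ∏ p ∈ n.primeFactors, (if p < P then c else 1) ≤ c ^ P := by
    rw [← prod_filter, prod_const]
    refine pow_le_pow_right₀ hc1 ?_
    calc _ ≤ #(range P) := card_le_card fun p => by simp
      _ = P := card_range P
  rw [Nat.card_divisors hn, hn']
  push_cast
  calc _ ≤ ∏ p ∈ n.primeFactors,
        (if p < P then c else 1) * ((p : ℝ) ^ n.factorization p) ^ η := by
        refine prod_le_prod (fun _ _ => by positivity) fun p hp => ?_
        split_ifs with h
        · exact hsmall _ _ (Nat.prime_of_mem_primeFactors hp).two_le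
        · simpa using hlarge _ _ (not_lt.mp h)
    _ ≤ _ := by
        rw [prod_mul_distrib]
        gcongr

open Finset in
/-- Pairs with product within `R` of `m`, counted through a bound on the divisor function. -/
theorem card_pairs_mul_near_le {S : Finset (ℕ × ℕ)} {M m : ℕ} {D R : ℝ} (hR : 0 ≤ R)
    (hD : ∀ n : ℕ, n ≠ 0 → n ≤ M → (#n.divisors : ℝ) ≤ D) (hD0 : 0 ≤ D)
    (hS0 : ∀ x ∈ S, x.1 * x.2 ≠ 0) (hSM : ∀ x ∈ S, x.1 * x.2 ≤ M)
    (hS : ∀ x ∈ S, |((x.1 : ℝ) * x.2) - m| ≤ R) :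
    (#S : ℝ) ≤ (2 * R + 1) * D := by
  have hmaps : ∀ x ∈ S, x.1 * x.2 ∈ Icc (m - ⌊R⌋₊) (m + ⌊R⌋₊) := by
    intro x hx
    have h : ((x.1 * x.2 : ℕ) - m : ℤ).natAbs ≤ ⌊R⌋₊ := by
      refine Nat.le_floor ?_
      rw [Nat.cast_natAbs]
      push_cast
      exact hS x hx
    rw [mem_Icc]
    omega
  have hcard : (#(Icc (m - ⌊R⌋₊) (m + ⌊R⌋₊)) : ℝ) ≤ 2 * R + 1 := by
    have h : #(Icc (m - ⌊R⌋₊) (m + ⌊R⌋₊)) ≤ 2 * ⌊R⌋₊ + 1 := by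
      rw [Nat.card_Icc]
      omega
    calc _ ≤ ((2 * ⌊R⌋₊ + 1 : ℕ) : ℝ) := by exact_mod_cast h
      _ ≤ _ := by
        push_cast
        linarith [Nat.floor_le hR]
  have hfiber (n : ℕ) : (#{x ∈ S | x.1 * x.2 = n} : ℝ) ≤ D := by
    rcases ({x ∈ S | x.1 * x.2 = n}).eq_empty_or_nonempty with h | ⟨x, hx⟩
    · simpa [h] using hD0
    obtain ⟨hxS, rfl⟩ := mem_filter.mp hx
    refine le_trans ?_ (hD _ (hS0 x hxS) (hSM x hxS))
    rw [← card_map ⟨fun d => (d, x.1 * x.2 / d), fun _ _ h => congr_arg Prod.fst h⟩,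
      Nat.map_div_right_divisors]
    refine Nat.cast_le.mpr (card_le_card fun y hy => ?_)
    rw [Nat.mem_divisorsAntidiagonal]
    exact ⟨(mem_filter.mp hy).2, hS0 x hxS⟩
  rw [card_eq_sum_card_fiberwise hmaps]
  push_cast
  calc _ ≤ ∑ _n ∈ Icc (m - ⌊R⌋₊) (m + ⌊R⌋₊), D := sum_le_sum fun n _ => hfiber n
    _ ≤ _ := by
      rw [sum_const, nsmul_eq_mul]
      gcongr

open Finset in
/-- Among `1, …, M`, the multiples of squares of elements of `P` that exceed `y`. -/
theorem sum_card_filter_sq_dvd_le (P : Finset ℕ) (M : ℕ) {y : ℝ} (hy : 0 < y)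
    (hP : ∀ p ∈ P, y < p) :
    ∑ p ∈ P, (#{l ∈ Icc 1 M | p ^ 2 ∣ l} : ℝ) ≤ M * (2 / y) := by
  have hsub : P ⊆ Ioo ⌊y⌋₊ (P.sup id + 1) := fun p hp => by
    rw [mem_Ioo, Nat.floor_lt hy.le]
    exact ⟨hP p hp, Nat.lt_succ_of_le (le_sup (f := id) hp)⟩
  calc _ ≤ ∑ p ∈ P, (M : ℝ) * ((p : ℝ) ^ 2)⁻¹ := by
        refine sum_le_sum fun p _ => ?_
        rw [show Icc 1 M = Ioc 0 M from rfl, Nat.Ioc_filter_dvd_card_eq_div, ← div_eq_mul_inv]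
        exact_mod_cast Nat.cast_div_le
    _ ≤ M * ∑ p ∈ Ioo ⌊y⌋₊ (P.sup id + 1), ((p : ℝ) ^ 2)⁻¹ := by
        rw [← mul_sum]
        gcongr
    _ ≤ M * (2 / (⌊y⌋₊ + 1)) := by
        gcongr
        exact sum_Ioo_inv_sq_le _ _
    _ ≤ _ := by
        gcongr
        exact (Nat.lt_floor_add_one y).le

open Finset in
/-- **Estimate in the proof of Theorem 1.5.** The contribution of non-squarefree `l`
(divisible by `p²` for some prime `N^{1/15} < p ≤ 2√(2N)`) is at most
`N^{2 − δ − 1/15 + ε}`. -/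
theorem squarefull_contribution_bound (δ ε : ℝ) (hδ0 : 0 < δ) (hδ1 : δ < 1 / 2)
    (hε : 0 < ε) :
    ∃ N₀ : ℕ, ∀ N : ℕ, N₀ ≤ N →
      ∀ A B : Finset ℕ, A ⊆ Finset.Icc (N + 1) (2 * N) → B ⊆ Finset.Icc (N + 1) (2 * N) →
        (∑ p ∈ (Finset.range (4 * N + 1)).filter
              (fun p => Nat.Prime p ∧ (N : ℝ) ^ ((1 : ℝ) / 15) < (p : ℝ) ∧
                (p : ℝ) ≤ 2 * Real.sqrt (2 * N)),
            ∑ a ∈ A, ∑ b ∈ B,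
              (Set.ncard {l : ℤ |
                  |Real.sqrt (a * b) - (l : ℝ)| < (N : ℝ) ^ (-δ) ∧ (p : ℤ) ^ 2 ∣ l} : ℝ)) ≤
          (N : ℝ) ^ (2 - δ - 1 / 15 + ε) := by
  obtain ⟨C, hC1, hC⟩ := exists_card_divisors_le_mul_rpow (η := ε / 4) (by positivity)
  have hlim := ((tendsto_rpow_atTop (y := ε / 2) (by positivity)).comp
    tendsto_natCast_atTop_atTop).eventually_ge_atTop (90 * (C * 4 ^ (ε / 4)))
  obtain ⟨N₀, hN₀⟩ := Filter.eventually_atTop.mp (hlim.and (Filter.eventually_ge_atTop 1))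
  refine ⟨N₀, fun N hN A B hA hB => ?_⟩
  obtain ⟨hNC, hN1⟩ := hN₀ N hN
  simp only [Function.comp_apply] at hNC
  have hN1' : (1 : ℝ) ≤ N := by exact_mod_cast hN1
  have hN0 : (0 : ℝ) < N := by positivity
  set Δ : ℝ := (N : ℝ) ^ (-δ) with hΔ
  have hΔ0 : 0 < Δ := by positivity
  have hΔ1 : Δ ≤ 1 := Real.rpow_le_one_of_one_le_of_nonpos hN1' (by linarith)
  have hNΔ : 1 ≤ N * Δ := by
    rw [hΔ, ← Real.rpow_one_add' hN0.le (by linarith)]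
    exact Real.one_le_rpow hN1' (by linarith)
  set D : ℝ := C * (4 * N ^ 2 : ℝ) ^ (ε / 4) with hD
  have hD0 : 0 ≤ D := by positivity
  have hDn (n : ℕ) (hn : n ≠ 0) (hnN : n ≤ 4 * N ^ 2) : (#n.divisors : ℝ) ≤ D := by
    refine (hC n hn).trans ?_
    rw [hD]
    gcongr
    exact_mod_cast hnN
  have hAB : ∀ x ∈ A ×ˢ B, N + 1 ≤ x.1 ∧ x.1 ≤ 2 * N ∧ N + 1 ≤ x.2 ∧ x.2 ≤ 2 * N := by
    intro x hx
    have h1 := mem_Icc.mp (hA (mem_product.mp hx).1)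
    have h2 := mem_Icc.mp (hB (mem_product.mp hx).2)
    exact ⟨h1.1, h1.2, h2.1, h2.2⟩
  have hsqrt : ∀ x ∈ A ×ˢ B, (N : ℝ) + 1 ≤ √((x.1 : ℝ) * x.2) ∧ √((x.1 : ℝ) * x.2) ≤ 2 * N := by
    intro x hx
    obtain ⟨h1, h2, h3, h4⟩ := hAB x hx
    constructor
    · refine Real.le_sqrt_of_sq_le ?_
      rw [sq]
      exact_mod_cast Nat.mul_le_mul h1 h3
    · refine Real.sqrt_le_iff.mpr ⟨by positivity, ?_⟩
      rw [sq]
      exact_mod_cast Nat.mul_le_mul h2 h4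
  have hncard (p : ℕ) : ∀ x ∈ A ×ˢ B,
      Set.ncard {l : ℤ | |√((x.1 : ℝ) * x.2) - (l : ℝ)| < Δ ∧ (p : ℤ) ^ 2 ∣ l} ≤
        #{l ∈ {l ∈ Icc 1 (3 * N) | p ^ 2 ∣ l} | |√((x.1 : ℝ) * x.2) - (l : ℕ)| < Δ} := by
    intro x hx
    obtain ⟨h1, h2⟩ := hsqrt x hx
    refine le_trans ?_ (card_image_le (f := fun l : ℕ => (l : ℤ)))
    rw [← Set.ncard_coe_finset]
    refine Set.ncard_le_ncard ?_ (finite_toSet _)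
    rintro l ⟨hl, hpl⟩
    obtain ⟨hl1, hl2⟩ := abs_lt.mp hl
    have hl0 : (0 : ℝ) < (l : ℝ) := by linarith
    have hl3 : (l : ℝ) < 2 * N + 1 := by linarith
    norm_cast at hl0 hl3
    lift l to ℕ using hl0.le
    simp only [coe_image, Set.mem_image, mem_coe, mem_filter, mem_Icc]
    refine ⟨l, ⟨⟨⟨by omega, by omega⟩, by exact_mod_cast hpl⟩, by exact_mod_cast hl⟩, rfl⟩
  have hpairs : ∀ l ∈ Icc 1 (3 * N),
      (#{x ∈ A ×ˢ B | |√((x.1 : ℝ) * x.2) - (l : ℕ)| < Δ} : ℝ) ≤ 15 * (N * Δ) * D := by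
    intro l hl
    have hlN : (l : ℝ) ≤ 3 * N := by exact_mod_cast (mem_Icc.mp hl).2
    have := card_pairs_mul_near_le (S := {x ∈ A ×ˢ B | |√((x.1 : ℝ) * x.2) - (l : ℕ)| < Δ})
      (m := l ^ 2) (R := 7 * (N * Δ)) (by positivity) hDn hD0
    refine (this ?_ ?_ ?_).trans ?_
    · intro x hx
      obtain ⟨h1, h2, h3, h4⟩ := hAB x (mem_filter.mp hx).1
      exact Nat.mul_ne_zero (by omega) (by omega)
    · intro x hx
      obtain ⟨h1, h2, h3, h4⟩ := hAB x (mem_filter.mp hx).1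
      nlinarith
    · intro x hx
      obtain ⟨hx, hxl⟩ := mem_filter.mp hx
      obtain ⟨h1, h2⟩ := hsqrt x hx
      have hfac : (x.1 : ℝ) * x.2 - (l ^ 2 : ℕ) =
          (√((x.1 : ℝ) * x.2) - l) * (√((x.1 : ℝ) * x.2) + l) := by
        push_cast
        linear_combination -Real.mul_self_sqrt (by positivity : 0 ≤ (x.1 : ℝ) * x.2)
      rw [hfac, abs_mul, abs_of_nonneg (by positivity : 0 ≤ √((x.1 : ℝ) * x.2) + l)]
      calc _ ≤ Δ * (7 * N) := by gcongr; linarith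
        _ = _ := by ring
    · gcongr
      linarith
  calc _ ≤ ∑ p ∈ (range (4 * N + 1)).filter
            (fun p => Nat.Prime p ∧ (N : ℝ) ^ ((1 : ℝ) / 15) < (p : ℝ) ∧
              (p : ℝ) ≤ 2 * Real.sqrt (2 * N)),
          (#{l ∈ Icc 1 (3 * N) | p ^ 2 ∣ l} : ℝ) * (15 * (N * Δ) * D) := by
        refine sum_le_sum fun p _ => ?_
        rw [← sum_product' A B (fun a b => (Set.ncard {l : ℤ |
          |Real.sqrt (a * b) - (l : ℝ)| < Δ ∧ (p : ℤ) ^ 2 ∣ l} : ℝ))]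
        calc _ ≤ ∑ x ∈ A ×ˢ B, (#{l ∈ {l ∈ Icc 1 (3 * N) | p ^ 2 ∣ l} |
              |√((x.1 : ℝ) * x.2) - (l : ℕ)| < Δ} : ℝ) :=
              sum_le_sum fun x hx => Nat.cast_le.mpr (hncard p x hx)
          _ = ∑ l ∈ Icc 1 (3 * N) with p ^ 2 ∣ l,
              (#{x ∈ A ×ˢ B | |√((x.1 : ℝ) * x.2) - (l : ℕ)| < Δ} : ℝ) := by
              exact_mod_cast sum_card_bipartiteAbove_eq_sum_card_bipartiteBelow
                (fun (x : ℕ × ℕ) (l : ℕ) => |√((x.1 : ℝ) * x.2) - (l : ℕ)| < Δ)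
          _ ≤ _ := by
              rw [← nsmul_eq_mul]
              exact sum_le_card_nsmul _ _ _ fun l hl => hpairs l (mem_filter.mp hl).1
    _ ≤ ((3 * N : ℕ) * (2 / (N : ℝ) ^ ((1 : ℝ) / 15))) * (15 * (N * Δ) * D) := by
        rw [← sum_mul]
        gcongr
        exact sum_card_filter_sq_dvd_le _ _ (by positivity) fun p hp => (mem_filter.mp hp).2.2.1
    _ = 90 * (C * 4 ^ (ε / 4)) * (N : ℝ) ^ (2 - δ - 1 / 15 + ε / 2) := by
        have hsplit : (N : ℝ) ^ (2 - δ - 1 / 15 + ε / 2) =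
            N * N * Δ * ((N : ℝ) ^ ((1 : ℝ) / 15))⁻¹ * ((N : ℝ) ^ 2) ^ (ε / 4) := by
          rw [show 2 - δ - 1 / 15 + ε / 2 = 1 + 1 + -δ + -(1 / 15) + (2 : ℕ) * (ε / 4) by
            push_cast; ring, Real.rpow_add hN0, Real.rpow_add hN0, Real.rpow_add hN0,
            Real.rpow_add hN0, Real.rpow_one, Real.rpow_neg hN0.le (1 / 15),
            Real.rpow_natCast_mul hN0.le]
        rw [hsplit, hD, Real.mul_rpow (by norm_num) (by positivity)]
        push_cast
        ring
    _ ≤ (N : ℝ) ^ (ε / 2) * (N : ℝ) ^ (2 - δ - 1 / 15 + ε / 2) := by gcongr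
    _ = _ := by
        rw [← Real.rpow_add hN0]
        congr 1
        ring
end

section
/- For every real δ with 0 < δ < 121/10000, one has (6/(1−2δ)) · ( log(4−10δ) + ∫₂^{3−10δ} (log(s−1)/s) · log((4−10δ)/(s+1)) ds − (1/2)·log( ((4−10δ)/(5−10δ−15/4)) · (15/4) ) − (1/2)·∫₂^{3−10δ} (log(s−1)/s) · log( (4−10δ)(5−10δ)/(s+1) − 1 ) ds ) > 0.0023205. -/
open MeasureTheory intervalIntegral

namespace RatPoly

/-- The value at `t` of the polynomial with the given coefficients, lowest degree first. -/
noncomputable def eval : List ℚ → ℝ → ℝ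
  | [], _ => 0
  | a :: p, t => a + t * eval p t

/-- Sum of coefficient lists. -/
def add : List ℚ → List ℚ → List ℚ
  | [], q => q
  | p, [] => p
  | a :: p, b :: q => (a + b) :: add p q

/-- Multiplication of a coefficient list by a scalar. -/
def smul (c : ℚ) (p : List ℚ) : List ℚ := p.map (c * ·)

/-- Product of coefficient lists. -/
def mul : List ℚ → List ℚ → List ℚ
  | [], _ => []
  | a :: p, q => add (smul a q) (0 :: mul p q)

/-- Coefficients of `t ↦ t⁻ⁿ ∫₀ᵗ uⁿ⁻¹ p(u) du`. -/
def prim : ℕ → List ℚ → List ℚ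
  | _, [] => []
  | n, a :: p => a / n :: prim (n + 1) p

/-- The value at a rational point, as a computable rational number. -/
def evalRat : List ℚ → ℚ → ℚ
  | [], _ => 0
  | a :: p, t => a + t * evalRat p t

/-- The integral of the polynomial over `[-h, h]`. -/
def integral (p : List ℚ) (h : ℚ) : ℚ :=
  h * evalRat (prim 1 p) h + h * evalRat (prim 1 p) (-h)

theorem eval_add (p q : List ℚ) (t : ℝ) : eval (add p q) t = eval p t + eval q t := by
  fun_induction add p q with
  | case1 q => simp [eval]
  | case2 p => simp [eval]
  | case3 a p b q ih => simp only [eval, ih]; push_cast; ring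

theorem eval_smul (c : ℚ) (p : List ℚ) (t : ℝ) : eval (smul c p) t = c * eval p t := by
  induction p with
  | nil => simp [eval, smul]
  | cons a p ih =>
    simp only [smul, List.map_cons, eval] at ih ⊢
    rw [ih]; push_cast; ring

theorem eval_mul (p q : List ℚ) (t : ℝ) : eval (mul p q) t = eval p t * eval q t := by
  induction p with
  | nil => simp [eval, mul]
  | cons a p ih => simp only [mul, eval_add, eval_smul, eval, ih]; push_cast; ring

theorem eval_append_singleton (p : List ℚ) (c : ℚ) (t : ℝ) :
    eval (p ++ [c]) t = eval p t + c * t ^ p.length := by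
  induction p with
  | nil => simp [eval]
  | cons a p ih => simp only [List.cons_append, eval, ih, List.length_cons]; ring

theorem eval_map_range (f : ℕ → ℚ) (n : ℕ) (t : ℝ) :
    eval ((List.range n).map f) t = ∑ i ∈ Finset.range n, (f i : ℝ) * t ^ i := by
  induction n with
  | zero => simp [eval]
  | succ n ih =>
    rw [List.range_succ, List.map_append, List.map_singleton, eval_append_singleton, ih,
      Finset.sum_range_succ]
    simp

theorem eval_ratCast (p : List ℚ) (t : ℚ) : eval p t = evalRat p t := by
  induction p with
  | nil => simp [eval, evalRat]
  | cons a p ih => simp [eval, evalRat, ih]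

theorem continuous_eval (p : List ℚ) : Continuous (eval p) := by
  induction p with
  | nil => exact continuous_const
  | cons a p ih => exact continuous_const.add (continuous_id.mul ih)

theorem hasDerivAt_prim (p : List ℚ) (n : ℕ) (t : ℝ) :
    HasDerivAt (fun t => t ^ (n + 1) * eval (prim (n + 1) p) t) (t ^ n * eval p t) t := by
  induction p generalizing n with
  | nil => simpa [prim, eval] using hasDerivAt_const t (0 : ℝ)
  | cons a p ih =>
    have h := ((hasDerivAt_pow (n + 1) t).const_mul ((a : ℝ) / (n + 1))).add (ih (n + 1))
    refine (h.congr_deriv ?_).congr_of_eventuallyEq (Filter.Eventually.of_forall fun x => ?_)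
    · have : (n : ℝ) + 1 ≠ 0 := by positivity
      simp only [eval, Nat.add_sub_cancel]
      push_cast
      field_simp
      ring
    · simp only [prim, eval, Pi.add_apply]
      push_cast
      ring

theorem integral_eval (p : List ℚ) (h : ℚ) :
    ∫ t in (-h : ℝ)..h, eval p t = integral p h := by
  have hd : ∀ t ∈ Set.uIcc (-h : ℝ) h,
      HasDerivAt (fun t => t * eval (prim 1 p) t) (eval p t) t := fun t _ => by
    simpa using hasDerivAt_prim p 0 t
  rw [integral_eq_sub_of_hasDerivAt hd ((continuous_eval p).intervalIntegrable _ _),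
    integral, ← Rat.cast_neg, eval_ratCast, eval_ratCast]
  push_cast
  ring

/-- A Taylor polynomial of `log (1 + r t)`, with an error term weighted by `κ`. -/
def logUpper (r κ : ℚ) (n : ℕ) : List ℚ :=
  0 :: ((List.range n).map (fun i : ℕ => -(-r) ^ (i + 1) / ((i : ℚ) + 1)) ++ [κ * r ^ (n + 1)])

/-- A Taylor polynomial of `1 / (1 + r t)`, with an error term weighted by `κ`. -/
def invUpper (r κ : ℚ) (n : ℕ) : List ℚ :=
  (List.range n).map (fun i : ℕ => (-r) ^ i) ++ [κ * r ^ n]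

theorem log_le_eval_logUpper {r κ : ℚ} {n : ℕ} {t : ℝ} (hn : Odd n) (hrt : |r * t| < 1)
    (hκ : 1 ≤ κ * (1 - |r * t|)) : Real.log (1 + r * t) ≤ eval (logUpper r κ n) t := by
  have h := (abs_le.1 (Real.abs_log_sub_add_sum_range_le (x := -(r * t)) (by rwa [abs_neg]) n)).2
  rw [abs_neg, (hn.add_one).pow_abs, sub_neg_eq_add] at h
  have hpow : (0 : ℝ) ≤ (r * t) ^ (n + 1) := (hn.add_one).pow_nonneg _
  have hpos : 0 < 1 - |r * t| := by linarith
  have herr : (r * t) ^ (n + 1) / (1 - |r * t|) ≤ κ * (r * t) ^ (n + 1) := by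
    rw [div_le_iff₀ hpos]
    nlinarith
  have heval : eval (logUpper r κ n) t =
      -(∑ i ∈ Finset.range n, (-(r * t)) ^ (i + 1) / (i + 1)) + κ * (r * t) ^ (n + 1) := by
    rw [logUpper, eval, eval_append_singleton, eval_map_range, mul_add, Finset.mul_sum,
      ← Finset.sum_neg_distrib, List.length_map, List.length_range]
    push_cast
    rw [zero_add]
    congr 1
    · refine Finset.sum_congr rfl fun i _ => ?_
      rw [← neg_mul, mul_pow]
      ring
    · ring
  linarith

theorem inv_le_eval_invUpper {r κ : ℚ} {n : ℕ} {t : ℝ} (hn : Even n) (hrt : 0 < 1 + r * t)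
    (hκ : 1 ≤ κ * (1 + r * t)) : (1 + r * t)⁻¹ ≤ eval (invUpper r κ n) t := by
  have hpow : (0 : ℝ) ≤ (r * t) ^ n := hn.pow_nonneg _
  have hgeom := mul_neg_geom_sum (-(r * t) : ℝ) n
  rw [hn.neg_pow] at hgeom
  have heval : eval (invUpper r κ n) t =
      ∑ i ∈ Finset.range n, (-(r * t)) ^ i + κ * (r * t) ^ n := by
    rw [invUpper, eval_append_singleton, eval_map_range, List.length_map, List.length_range]
    push_cast
    congr 1
    · refine Finset.sum_congr rfl fun i _ => ?_
      rw [← neg_mul, mul_pow]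
    · ring
  rw [heval, inv_le_iff_one_le_mul₀ hrt]
  nlinarith

end RatPoly

theorem log_le_of_sum_range_le {x b : ℝ} (n : ℕ) (hx : |1 - x| < 1)
    (h : |1 - x| ^ (n + 1) / (1 - |1 - x|) -
      ∑ i ∈ Finset.range n, (1 - x) ^ (i + 1) / (i + 1) ≤ b) : Real.log x ≤ b := by
  have := (abs_le.1 (Real.abs_log_sub_add_sum_range_le hx n)).2
  rw [sub_sub_cancel] at this
  linarith

theorem le_log_of_le_sum_range {x b : ℝ} (n : ℕ) (hx : |1 - x| < 1)
    (h : b ≤ -(|1 - x| ^ (n + 1) / (1 - |1 - x|)) -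
      ∑ i ∈ Finset.range n, (1 - x) ^ (i + 1) / (i + 1)) : b ≤ Real.log x := by
  have := (abs_le.1 (Real.abs_log_sub_add_sum_range_le hx n)).1
  rw [sub_sub_cancel] at this
  linarith

theorem log_14395_le : Real.log (14395 / 10000) ≤ 0.3642958312 := by
  have h1 : Real.log (6 / 5) ≤ 0.182321556833 :=
    log_le_of_sum_range_le 16 (by norm_num [abs_lt]) (by norm_num [Finset.sum_range_succ, abs_div])
  have h2 : Real.log (2879 / 2880) ≤ -0.0003472825 :=
    log_le_of_sum_range_le 3 (by norm_num [abs_lt]) (by norm_num [Finset.sum_range_succ, abs_div])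
  have h : Real.log (14395 / 10000) = 2 * Real.log (6 / 5) + Real.log (2879 / 2880) := by
    rw [two_mul, ← Real.log_mul (by norm_num) (by norm_num),
      ← Real.log_mul (by norm_num) (by norm_num)]
    norm_num
  linarith

theorem log_center_le :
    Real.log (34395 / 10000) + Real.log (15486141 / 1000000) - 2 * Real.log (3879 / 1000) ≤
      1.2641168306 := by
  have h1 : Real.log (11836573771 / 13374792000) ≤ -0.1221775311 :=
    log_le_of_sum_range_le 14 (by norm_num [abs_lt]) (by norm_num [Finset.sum_range_succ, abs_div])
  have h : Real.log (34395 / 10000) + Real.log (15486141 / 1000000) - 2 * Real.log (3879 / 1000) =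
      2 * Real.log 2 + Real.log (11836573771 / 13374792000) := by
    rw [sub_eq_iff_eq_add, two_mul, two_mul]
    simp only [← Real.log_mul, ne_eq, OfNat.ofNat_ne_zero, div_eq_zero_iff, mul_eq_zero, or_self,
      not_false_eq_true]
    norm_num
  linarith [Real.log_two_lt_d9]

theorem le_log_main :
    0.1551538336 ≤ Real.log (3879 / 1000) + Real.log (1129 / 1000) - Real.log (15 / 4) := by
  have h1 : 0.1551538336 ≤ Real.log (1459797 / 1250000) :=
    le_log_of_le_sum_range 14 (by norm_num [abs_lt]) (by norm_num [Finset.sum_range_succ, abs_div])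
  rw [← Real.log_mul (by norm_num) (by norm_num), ← Real.log_div (by norm_num) (by norm_num)]
  norm_num at h1 ⊢
  exact h1

/-- The combined integrand, in terms of `a = 4 - 10 δ`. -/
noncomputable def sieveIntegrand (a s : ℝ) : ℝ :=
  Real.log (s - 1) / s * ((Real.log (s + 1) + Real.log (a ^ 2 + a - 1 - s)) / 2 - Real.log a)

/-- A polynomial upper bound for `log (1.4395 + t)`. -/
def logPoly : List ℚ :=
  RatPoly.add [0.3642958312] (RatPoly.logUpper (2000 / 2879) (36 / 25) 15)

/-- A polynomial upper bound for the second factor of `sieveIntegrand 3.879 (2.4395 + t)`. -/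
def factorPoly : List ℚ :=
  RatPoly.smul (1 / 2) (RatPoly.add [1.2641168306]
    (RatPoly.add (RatPoly.logUpper (2000 / 6879) (23 / 20) 9)
      (RatPoly.logUpper (-(1000000 / 15486141)) (21 / 20) 5)))

/-- A polynomial upper bound for `1 / (2.4395 + t)`. -/
def invPoly : List ℚ :=
  RatPoly.smul (2000 / 4879) (RatPoly.invUpper (2000 / 4879) (5 / 4) 14)

theorem integral_poly_le :
    RatPoly.integral (RatPoly.mul (RatPoly.mul logPoly factorPoly) invPoly) (879 / 2000) ≤
      0.0771995259 := by
  norm_num [RatPoly.integral, RatPoly.mul, RatPoly.add, RatPoly.smul, logPoly, factorPoly, invPoly,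
    RatPoly.logUpper, RatPoly.invUpper, List.range_succ, RatPoly.prim, RatPoly.evalRat]

theorem log_le_eval_logPoly {t : ℝ} (ht : |t| ≤ 879 / 2000) :
    Real.log (2879 / 2000 + t) ≤ RatPoly.eval logPoly t := by
  have hr : |((2000 / 2879 : ℚ) : ℝ) * t| ≤ 879 / 2879 := by
    rw [abs_mul]; push_cast; norm_num [abs_div]; linarith
  have h := RatPoly.log_le_eval_logUpper (r := 2000 / 2879) (κ := 36 / 25) (n := 15) (t := t)
    (by decide) (by linarith) (by push_cast at hr ⊢; linarith)
  have hpos := (abs_le.1 hr).1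
  push_cast at h hpos
  rw [show 2879 / 2000 + t = 14395 / 10000 * (1 + 2000 / 2879 * t) by ring,
    Real.log_mul (by norm_num) (by linarith), logPoly, RatPoly.eval_add]
  have hc : RatPoly.eval [0.3642958312] t = 0.3642958312 := by norm_num [RatPoly.eval]
  linarith [log_14395_le]

theorem factor_le_eval_factorPoly {t : ℝ} (ht : |t| ≤ 879 / 2000) :
    (Real.log (6879 / 2000 + t) + Real.log (15486141 / 1000000 - t)) / 2 -
      Real.log (3879 / 1000) ≤ RatPoly.eval factorPoly t := by
  have hr : |((2000 / 6879 : ℚ) : ℝ) * t| ≤ 879 / 6879 := by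
    rw [abs_mul]; push_cast; norm_num [abs_div]; linarith
  have hr' : |((-(1000000 / 15486141) : ℚ) : ℝ) * t| ≤ 1 / 30 := by
    rw [abs_mul]; push_cast; norm_num [abs_div]; linarith
  have h := RatPoly.log_le_eval_logUpper (r := 2000 / 6879) (κ := 23 / 20) (n := 9) (t := t)
    (by decide) (by linarith) (by push_cast at hr ⊢; linarith)
  have h' := RatPoly.log_le_eval_logUpper (r := -(1000000 / 15486141)) (κ := 21 / 20) (n := 5)
    (t := t) (by decide) (by linarith) (by push_cast at hr' ⊢; linarith)
  have hpos := (abs_le.1 hr).1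
  have hpos' := (abs_le.1 hr').1
  push_cast at h h' hpos hpos'
  rw [show 6879 / 2000 + t = 34395 / 10000 * (1 + 2000 / 6879 * t) by ring,
    show 15486141 / 1000000 - t = 15486141 / 1000000 * (1 + -(1000000 / 15486141) * t) by ring,
    Real.log_mul (by norm_num) (by linarith), Real.log_mul (by norm_num) (by linarith),
    factorPoly, RatPoly.eval_smul, RatPoly.eval_add, RatPoly.eval_add]
  have hc : RatPoly.eval [1.2641168306] t = 1.2641168306 := by norm_num [RatPoly.eval]
  push_cast
  linarith [log_center_le]

theorem inv_le_eval_invPoly {t : ℝ} (ht : |t| ≤ 879 / 2000) :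
    (4879 / 2000 + t)⁻¹ ≤ RatPoly.eval invPoly t := by
  have hpos := (abs_le.1 ht).1
  have h := RatPoly.inv_le_eval_invUpper (r := 2000 / 4879) (κ := 5 / 4) (n := 14) (t := t)
    (by decide) (by push_cast; linarith) (by push_cast; linarith)
  push_cast at h
  rw [show 4879 / 2000 + t = 4879 / 2000 * (1 + 2000 / 4879 * t) by ring, mul_inv,
    invPoly, RatPoly.eval_smul]
  push_cast
  linarith

theorem continuousOn_sieveIntegrand {a x : ℝ} (hx : x ≤ a) (ha : 2 ≤ a) :
    ContinuousOn (sieveIntegrand a) (Set.Icc 2 x) := by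
  refine ContinuousOn.mul (ContinuousOn.div (ContinuousOn.log (by fun_prop) ?_) (by fun_prop) ?_)
    (ContinuousOn.sub (ContinuousOn.div_const (ContinuousOn.add
      (ContinuousOn.log (by fun_prop) ?_) (ContinuousOn.log (by fun_prop) ?_)) _) (by fun_prop))
  all_goals
    rintro s ⟨h1, h2⟩
    nlinarith

theorem sieveIntegrand_le_eval {t : ℝ} (ht : |t| ≤ 879 / 2000) :
    sieveIntegrand (3879 / 1000) (4879 / 2000 + t) ≤
      RatPoly.eval (RatPoly.mul (RatPoly.mul logPoly factorPoly) invPoly) t := by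
  obtain ⟨h1, h2⟩ := abs_le.1 ht
  have e1 : 4879 / 2000 + t - 1 = 2879 / 2000 + t := by ring
  have e2 : 4879 / 2000 + t + 1 = 6879 / 2000 + t := by ring
  have e3 : (3879 / 1000 : ℝ) ^ 2 + 3879 / 1000 - 1 - (4879 / 2000 + t) =
    15486141 / 1000000 - t := by ring
  rw [sieveIntegrand, e1, e2, e3, RatPoly.eval_mul, RatPoly.eval_mul, div_mul_eq_mul_div,
    div_eq_mul_inv]
  have hl := log_le_eval_logPoly ht
  have hf := factor_le_eval_factorPoly ht
  have hl0 : 0 ≤ Real.log (2879 / 2000 + t) := Real.log_nonneg (by linarith)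
  have hf0 : 0 ≤ (Real.log (6879 / 2000 + t) + Real.log (15486141 / 1000000 - t)) / 2 -
      Real.log (3879 / 1000) := by
    have h := Real.log_le_log (x := (3879 / 1000 : ℝ) * (3879 / 1000)) (by norm_num)
      (show _ ≤ (6879 / 2000 + t) * (15486141 / 1000000 - t) by nlinarith)
    rw [Real.log_mul (by norm_num) (by norm_num),
      Real.log_mul (by linarith) (by linarith)] at h
    linarith
  have hi0 : 0 ≤ (4879 / 2000 + t)⁻¹ := inv_nonneg.2 (by linarith)
  exact mul_le_mul (mul_le_mul hl hf hf0 (hl0.trans hl)) (inv_le_eval_invPoly ht) hi0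
    (mul_nonneg (hl0.trans hl) (hf0.trans hf))

theorem integral_sieveIntegrand_le :
    ∫ s in (2 : ℝ)..(2879 / 1000), sieveIntegrand (3879 / 1000) s ≤ 0.0771995259 := by
  have hshift := integral_comp_add_left (a := -(879 / 2000 : ℝ)) (b := 879 / 2000)
    (sieveIntegrand (3879 / 1000)) (4879 / 2000)
  rw [show (4879 / 2000 : ℝ) + -(879 / 2000) = 2 by norm_num,
    show (4879 / 2000 : ℝ) + 879 / 2000 = 2879 / 1000 by norm_num] at hshift
  rw [← hshift]
  have hpoly := RatPoly.integral_eval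
    (RatPoly.mul (RatPoly.mul logPoly factorPoly) invPoly) (879 / 2000)
  have hle := (Rat.cast_le (K := ℝ)).2 integral_poly_le
  rw [← hpoly] at hle
  push_cast at hle
  refine le_trans (integral_mono_on (by norm_num) ?_
    ((RatPoly.continuous_eval _).intervalIntegrable _ _)
    fun t ht => sieveIntegrand_le_eval (abs_le.2 ht)) (hle.trans (by norm_num))
  refine ContinuousOn.intervalIntegrable_of_Icc (by norm_num) ?_
  refine (continuousOn_sieveIntegrand (x := 2879 / 1000) (by norm_num) (by norm_num)).comp
    (by fun_prop) fun t ht => ?_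
  obtain ⟨h1, h2⟩ := ht
  constructor <;> linarith

theorem log_sub_one_div_le {s : ℝ} (h2 : 2 ≤ s) (h3 : s ≤ 3) : Real.log (s - 1) / s ≤ 6 / 25 := by
  have h := Real.log_le_sub_one_of_pos (x := (s - 1) / 2) (by linarith)
  rw [Real.log_div (by linarith) (by norm_num)] at h
  rw [div_le_iff₀ (by linarith)]
  linarith [Real.log_two_lt_d9]

theorem log_sub_one_div_nonneg {s : ℝ} (h2 : 2 ≤ s) : 0 ≤ Real.log (s - 1) / s :=
  div_nonneg (Real.log_nonneg (by linarith)) (by linarith)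

theorem sieveIntegrand_le {a s : ℝ} (ha : 3 ≤ a) (ha4 : a ≤ 4) (h2 : 2 ≤ s) (hs : s ≤ a - 1) :
    sieveIntegrand a s ≤ 1 / 5 := by
  have hlog : (Real.log (s + 1) + Real.log (a ^ 2 + a - 1 - s)) / 2 - Real.log a ≤ 7 / 10 := by
    have h := Real.log_le_log (y := a ^ 3)
      (show 0 < (s + 1) * (a ^ 2 + a - 1 - s) from mul_pos (by linarith) (by nlinarith))
      (by nlinarith [mul_nonneg (sub_nonneg.2 hs) (show 0 ≤ a ^ 2 - s - 1 by nlinarith)])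
    rw [Real.log_mul (by linarith) (by nlinarith), Real.log_pow] at h
    have h4 := Real.log_le_log (by linarith) ha4
    rw [show (4 : ℝ) = 2 ^ 2 by norm_num, Real.log_pow] at h4
    push_cast at h h4
    linarith [Real.log_two_lt_d9]
  have h0 := log_sub_one_div_nonneg h2
  have h1 := log_sub_one_div_le h2 (by linarith)
  rw [sieveIntegrand]
  nlinarith

theorem sieveIntegrand_sub_le {a b s : ℝ} (hb : 3879 / 1000 ≤ b) (hba : b ≤ a) (ha : a ≤ 4)
    (h2 : 2 ≤ s) (hs : s ≤ b - 1) :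
    sieveIntegrand a s ≤ sieveIntegrand b s + 2 / 25 * (a - b) := by
  have hbs : 15 ≤ b ^ 2 + b - 1 - s := by nlinarith
  have has : 15 ≤ a ^ 2 + a - 1 - s := by nlinarith
  have hlog : Real.log (a ^ 2 + a - 1 - s) - Real.log (b ^ 2 + b - 1 - s) ≤ 3 / 5 * (a - b) := by
    rw [← Real.log_div (by linarith) (by linarith)]
    refine (Real.log_le_sub_one_of_pos (by apply div_pos <;> linarith)).trans ?_
    rw [div_sub_one (by linarith), div_le_iff₀ (by linarith)]
    nlinarith [mul_nonneg (sub_nonneg.2 hba) (show 0 ≤ 9 - (a + b + 1) by linarith),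
      mul_nonneg (sub_nonneg.2 hba) (sub_nonneg.2 hbs)]
  have hmono := Real.log_le_log (by linarith) hba
  have h0 := log_sub_one_div_nonneg h2
  have h1 := log_sub_one_div_le h2 (by linarith)
  have hdiff : sieveIntegrand a s - sieveIntegrand b s ≤
      Real.log (s - 1) / s * (3 / 10 * (a - b)) := by
    rw [sieveIntegrand, sieveIntegrand, ← mul_sub]
    exact mul_le_mul_of_nonneg_left (by linarith) h0
  nlinarith

theorem integral_sieveIntegrand_le_add {a b : ℝ} (hb : 3879 / 1000 ≤ b) (hba : b ≤ a)
    (ha : a ≤ 4) :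
    ∫ s in (2 : ℝ)..(a - 1), sieveIntegrand a s ≤
      (∫ s in (2 : ℝ)..(b - 1), sieveIntegrand b s) + 3 / 10 * (a - b) := by
  have hca := continuousOn_sieveIntegrand (a := a) (x := a - 1) (by linarith) (by linarith)
  have hcb := continuousOn_sieveIntegrand (a := b) (x := b - 1) (by linarith) (by linarith)
  have hi1 : IntervalIntegrable (sieveIntegrand a) volume 2 (b - 1) :=
    (hca.mono (Set.Icc_subset_Icc_right (by linarith))).intervalIntegrable_of_Icc (by linarith)
  have hi2 : IntervalIntegrable (sieveIntegrand a) volume (b - 1) (a - 1) :=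
    (hca.mono (Set.Icc_subset_Icc_left (by linarith))).intervalIntegrable_of_Icc (by linarith)
  have hib : IntervalIntegrable (sieveIntegrand b) volume 2 (b - 1) :=
    hcb.intervalIntegrable_of_Icc (by linarith)
  rw [← integral_add_adjacent_intervals hi1 hi2]
  have h1 := integral_mono_on (g := fun s => sieveIntegrand b s + 2 / 25 * (a - b))
    (by linarith : (2 : ℝ) ≤ b - 1) hi1 (hib.add intervalIntegrable_const)
    fun s hs => sieveIntegrand_sub_le hb hba ha hs.1 hs.2
  have h2 := integral_mono_on (g := fun _ => 1 / 5) (by linarith : b - 1 ≤ a - 1) hi2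
    intervalIntegrable_const
    fun s hs => sieveIntegrand_le (by linarith) ha (by linarith [hs.1]) hs.2
  rw [intervalIntegral.integral_add hib intervalIntegrable_const, intervalIntegral.integral_const,
    smul_eq_mul] at h1
  rw [intervalIntegral.integral_const, smul_eq_mul] at h2
  nlinarith [mul_nonneg (sub_nonneg.2 hba) (show 0 ≤ 4 - b by linarith)]

theorem integral_sub_half_integral {a : ℝ} (ha : 3 ≤ a) :
    (∫ s in (2 : ℝ)..(a - 1), Real.log (s - 1) / s * Real.log (a / (s + 1))) -
      1 / 2 * ∫ s in (2 : ℝ)..(a - 1),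
        Real.log (s - 1) / s * Real.log (a * (a + 1) / (s + 1) - 1) =
      -∫ s in (2 : ℝ)..(a - 1), sieveIntegrand a s := by
  have hpos : ∀ s ∈ Set.Icc 2 (a - 1), 0 < a * (a + 1) / (s + 1) - 1 := fun s hs => by
    rw [sub_pos, one_lt_div (by linarith [hs.1])]
    nlinarith [hs.2]
  have hw : ContinuousOn (fun s => Real.log (s - 1) / s) (Set.Icc 2 (a - 1)) :=
    ContinuousOn.div (ContinuousOn.log (by fun_prop) fun s hs => by linarith [hs.1])
      (by fun_prop) fun s hs => by linarith [hs.1]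
  have hs1 : ∀ s ∈ Set.Icc 2 (a - 1), s + 1 ≠ 0 := fun s hs => by linarith [hs.1]
  have hi1 : IntervalIntegrable (fun s => Real.log (s - 1) / s * Real.log (a / (s + 1)))
      volume 2 (a - 1) := by
    refine ContinuousOn.intervalIntegrable_of_Icc (by linarith) (hw.mul (ContinuousOn.log
      (ContinuousOn.div (by fun_prop) (by fun_prop) hs1) fun s hs => ?_))
    exact div_ne_zero (by linarith) (hs1 s hs)
  have hi2 : IntervalIntegrable
      (fun s => Real.log (s - 1) / s * Real.log (a * (a + 1) / (s + 1) - 1))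
      volume 2 (a - 1) :=
    ContinuousOn.intervalIntegrable_of_Icc (by linarith) (hw.mul (ContinuousOn.log
      ((ContinuousOn.div (by fun_prop) (by fun_prop) hs1).sub continuousOn_const)
      fun s hs => (hpos s hs).ne'))
  rw [← intervalIntegral.integral_const_mul, ← intervalIntegral.integral_sub hi1 (hi2.const_mul _),
    ← intervalIntegral.integral_neg]
  refine integral_congr fun s hs => ?_
  rw [Set.uIcc_of_le (by linarith)] at hs
  have h := hpos s hs
  have hsa : a * (a + 1) / (s + 1) - 1 = (a ^ 2 + a - 1 - s) / (s + 1) := by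
    field_simp [hs1 s hs]
    ring
  have hne : a ^ 2 + a - 1 - s ≠ 0 := by nlinarith [hs.1, hs.2]
  simp only [sieveIntegrand]
  rw [hsa, Real.log_div hne (hs1 s hs), Real.log_div (by linarith) (hs1 s hs)]
  ring

/-- **Numerical inequality (5.12).** The sieve constant `C(δ,4)` exceeds `0.0023205`
for `0 < δ < 121/10000`. -/
theorem sieve_constant_k4_positive (δ : ℝ) (hδ0 : 0 < δ) (hδ1 : δ < 121 / 10000) :
    0.0023205 <
      6 / (1 - 2 * δ) *
        (Real.log (4 - 10 * δ) +
          (∫ s in (2 : ℝ)..(3 - 10 * δ),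
            Real.log (s - 1) / s * Real.log ((4 - 10 * δ) / (s + 1))) -
          1 / 2 * Real.log ((4 - 10 * δ) / (5 - 10 * δ - 15 / 4) * (15 / 4)) -
          1 / 2 * ∫ s in (2 : ℝ)..(3 - 10 * δ),
            Real.log (s - 1) / s *
              Real.log ((4 - 10 * δ) * (5 - 10 * δ) / (s + 1) - 1)) := by
  set a := 4 - 10 * δ with ha
  have hδ : δ = (4 - a) / 10 := by rw [ha]; ring
  have ha0 : 3879 / 1000 < a := by linarith
  have ha4 : a < 4 := by linarith
  have hint := integral_sub_half_integral (a := a) (by linarith)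
  have hle := integral_sieveIntegrand_le_add le_rfl ha0.le ha4.le
  have hnum := integral_sieveIntegrand_le
  rw [show (3879 / 1000 : ℝ) - 1 = 2879 / 1000 by norm_num] at hle
  have hlog : Real.log (a / (a - 11 / 4) * (15 / 4)) =
      Real.log a - Real.log (a - 11 / 4) + Real.log (15 / 4) := by
    rw [Real.log_mul (by apply div_ne_zero <;> linarith) (by norm_num),
      Real.log_div (by linarith) (by linarith)]
  have hmono := Real.log_le_log (by norm_num) ha0.le
  have hslope : 4 / 5 * (a - 3879 / 1000) ≤ Real.log (a - 11 / 4) - Real.log (1129 / 1000) := by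
    rw [← Real.log_div (by linarith) (by norm_num)]
    refine le_trans ?_ (Real.one_sub_inv_le_log_of_pos (div_pos (by linarith) (by norm_num)))
    rw [inv_div, one_sub_div (by linarith), le_div_iff₀ (by linarith)]
    nlinarith
  rw [show 3 - 10 * δ = a - 1 by rw [ha]; ring, show 5 - 10 * δ = a + 1 by rw [ha]; ring,
    show a + 1 - 15 / 4 = a - 11 / 4 by ring, hlog, div_mul_eq_mul_div, lt_div_iff₀ (by linarith)]
  linarith [le_log_main]
end
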